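/- arXiv:0911.2638 — 2 statements merged into one kernel-verified Lean document; each statement's English description precedes it below -/
import Mathlib

section
/- Let A : ℝ^d → ℝ^{d×d} be smooth, ℤ^d-periodic, symmetric and uniformly positive definite, and let χ = (χ¹,…,χ^d) : ℝ^d → ℝ^d be smooth ℤ^d-periodic solutions of the cell problems ∇·(A(y)(∇χ^j(y) + e_j)) = 0 for j = 1,…,d; define the homogenized matrix Ā = ∫_{[0,1]^d} A(y)(I + ∇χ(y)) dy. Let K ∈ 𝕂^{p',q} with q ≥ 1. Then there exists a constant C, independent of ε, η and p, such that for every ε > 0, every η = τ > 0, every nonzero p ∈ ℝ^d, and every C² function u^ε : ℝ^d × ℝ → ℝ satisfying ∂²_t u^ε = ∇·(A(x/ε)∇u^ε), u^ε(x,0) = p·x, ∂_t u^ε(x,0) = 0, with x ↦ u^ε(x,t) − p·x (εℤ^d)-periodic, the averaged flux F̃ := ∫∫ K_τ(t) K_η(x₁)⋯K_η(x_d) A(x/ε)∇u^ε(x,t) dx dt satisfies |F̃ − Āp| ≤ C |p| (ε/η)^q. -/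
open MeasureTheory Matrix

/-- The closed unit cell `[0,1]^d`. -/
def unitCell (d : ℕ) : Set (Fin d → ℝ) := Set.univ.pi fun _ => Set.Icc (0 : ℝ) 1

/-- Periodicity with respect to the lattice `ℤ^d`. -/
def LatticePeriodic {d : ℕ} {F : Type*} (f : (Fin d → ℝ) → F) : Prop :=
  ∀ (y : Fin d → ℝ) (k : Fin d → ℤ), f (y + fun i => (k i : ℝ)) = f y

/-- The partial derivative in the `i`-th coordinate direction. -/
noncomputable def partialDeriv {d : ℕ} (i : Fin d) (f : (Fin d → ℝ) → ℝ) (y : Fin d → ℝ) : ℝ :=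
  fderiv ℝ f y (Pi.single i 1)

section Cell

variable {d : ℕ}

lemma unitCell_eq_Icc : unitCell d = Set.Icc (0 : Fin d → ℝ) 1 := by
  rw [← Set.pi_univ_Icc]; rfl

lemma isCompact_unitCell : IsCompact (unitCell d) := by
  rw [unitCell_eq_Icc]; exact isCompact_Icc

lemma measurableSet_unitCell : MeasurableSet (unitCell d) :=
  isCompact_unitCell.measurableSet

lemma volume_real_unitCell : volume.real (unitCell d) = 1 := by
  rw [unitCell, measureReal_def, volume_pi_pi]; simp

lemma unitCell_ae_eq_Ico :
    unitCell d =ᵐ[volume] Set.univ.pi fun _ : Fin d => Set.Ico (0 : ℝ) 1 := by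
  rw [unitCell_eq_Icc]
  exact (Measure.univ_pi_Ico_ae_eq_Icc (f := (0 : Fin d → ℝ)) (g := 1)).symm

lemma Continuous.integrableOn_unitCell {f : (Fin d → ℝ) → ℝ} (hf : Continuous f) :
    IntegrableOn f (unitCell d) :=
  hf.continuousOn.integrableOn_compact isCompact_unitCell

/-- The integral of a periodic function over the unit cell is translation invariant. -/
lemma setIntegral_unitCell_add {f : (Fin d → ℝ) → ℝ} (hf : LatticePeriodic f) (z : Fin d → ℝ) :
    ∫ y in unitCell d, f (y + z) = ∫ y in unitCell d, f y := by
  have hP := ZSpan.isAddFundamentalDomain (Pi.basisFun ℝ (Fin d)) volume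
  rw [ZSpan.fundamentalDomain_pi_basisFun] at hP
  set P : Set (Fin d → ℝ) := Set.univ.pi fun _ : Fin d => Set.Ico (0 : ℝ) 1
  have hper : ∀ (g : Submodule.span ℤ (Set.range (Pi.basisFun ℝ (Fin d)))) (x : Fin d → ℝ),
      f (g +ᵥ x) = f x := by
    intro g x
    have hg := (Module.Basis.mem_span_iff_repr_mem ℤ (Pi.basisFun ℝ (Fin d))
      (g : Fin d → ℝ)).1 g.2
    have hg' : ∀ i, ∃ c : ℤ, (c : ℝ) = (g : Fin d → ℝ) i := fun i => by simpa using hg i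
    choose c hc using hg'
    have : (g +ᵥ x : Fin d → ℝ) = x + fun i => (c i : ℝ) := by
      ext i
      simp only [Submodule.vadd_def, vadd_eq_add, Pi.add_apply, hc i]
      ring
    rw [this, hf]
  have : VAddInvariantMeasure (Submodule.span ℤ (Set.range (Pi.basisFun ℝ (Fin d))))
      (Fin d → ℝ) volume :=
    inferInstanceAs <| VAddInvariantMeasure
      (Submodule.span ℤ (Set.range (Pi.basisFun ℝ (Fin d)))).toAddSubgroup (Fin d → ℝ) volume
  have hvadd := hP.vadd_of_comm z
  have key := hP.setIntegral_eq hvadd (f := f) hper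
  rw [setIntegral_congr_set unitCell_ae_eq_Ico, setIntegral_congr_set unitCell_ae_eq_Ico, key]
  have := (measurePreserving_add_right (volume : Measure (Fin d → ℝ)) z).setIntegral_image_emb
    (MeasurableEquiv.addRight z).measurableEmbedding f P
  rw [← this]
  congr 2
  ext x
  simp only [Set.mem_vadd_set, Set.mem_image, vadd_eq_add, add_comm z]

lemma integral_partialDeriv_eq_zero {f : (Fin d → ℝ) → ℝ} (hf : ContDiff ℝ 1 f)
    (hp : LatticePeriodic f) (i : Fin d) : ∫ y in unitCell d, partialDeriv i f y = 0 := by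
  obtain _ | n := d
  · exact i.elim0
  have hdf : ∀ x, HasFDerivAt (fun y => Pi.single (M := fun _ => ℝ) i (f y))
      ((ContinuousLinearMap.single ℝ (fun _ => ℝ) i).comp (fderiv ℝ f x)) x := fun x =>
    (ContinuousLinearMap.single ℝ (fun _ : Fin (n + 1) => ℝ) i).hasFDerivAt.comp x
      (hf.differentiable one_ne_zero x).hasFDerivAt
  have hsum : ∀ x, ∑ j : Fin (n + 1), ((ContinuousLinearMap.single ℝ (fun _ => ℝ) i).comp
      (fderiv ℝ f x)) (Pi.single j 1) j = partialDeriv i f x := by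
    intro x
    rw [Finset.sum_eq_single i]
    · simp [partialDeriv]
    · intro j _ hj; simp [Pi.single_eq_of_ne hj]
    · simp
  have hc : Continuous fun y => partialDeriv i f y :=
    (hf.continuous_fderiv one_ne_zero).clm_apply continuous_const
  have key := integral_divergence_of_hasFDerivAt_off_countable (0 : Fin (n + 1) → ℝ) 1
    zero_le_one (fun y => Pi.single (M := fun _ => ℝ) i (f y)) _ ∅ Set.countable_empty
    (fun x _ => (hdf x).continuousAt.continuousWithinAt) (fun x _ => hdf x)
    (by
      simp_rw [hsum]
      exact hc.continuousOn.integrableOn_compact isCompact_Icc)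
  simp_rw [hsum] at key
  rw [unitCell_eq_Icc, key]
  refine Finset.sum_eq_zero fun j _ => ?_
  by_cases hj : j = i
  · subst hj
    rw [sub_eq_zero]
    congr 1
    ext x
    simp only [Pi.single_eq_same, Pi.one_apply, Pi.zero_apply]
    rw [← hp (j.insertNth (0 : ℝ) x) (Pi.single j 1)]
    congr 1
    ext l
    refine Fin.succAboveCases j ?_ (fun l => ?_) l <;> simp
  · simp [Pi.single_eq_of_ne hj]

lemma partialDeriv_mul {f g : (Fin d → ℝ) → ℝ} (hf : ContDiff ℝ 1 f) (hg : ContDiff ℝ 1 g)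
    (i : Fin d) (y : Fin d → ℝ) :
    partialDeriv i (fun y => f y * g y) y
      = f y * partialDeriv i g y + partialDeriv i f y * g y := by
  unfold partialDeriv
  rw [fderiv_fun_mul (hf.differentiable one_ne_zero y) (hg.differentiable one_ne_zero y)]
  simp [mul_comm]

lemma continuous_partialDeriv {f : (Fin d → ℝ) → ℝ} (hf : ContDiff ℝ 1 f) (i : Fin d) :
    Continuous (partialDeriv i f) :=
  (hf.continuous_fderiv one_ne_zero).clm_apply continuous_const

lemma LatticePeriodic.partialDeriv {f : (Fin d → ℝ) → ℝ} (hf : LatticePeriodic f) (i : Fin d) :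
    LatticePeriodic (partialDeriv i f) := by
  intro y k
  unfold _root_.partialDeriv
  rw [← fderiv_comp_add_right]
  congr 2
  ext z
  exact hf z k

/-- Integration by parts on the unit cell for periodic functions. -/
lemma integral_mul_partialDeriv {f g : (Fin d → ℝ) → ℝ} (hf : ContDiff ℝ 1 f)
    (hg : ContDiff ℝ 1 g) (hfp : LatticePeriodic f) (hgp : LatticePeriodic g) (i : Fin d) :
    ∫ y in unitCell d, f y * partialDeriv i g y
      = -∫ y in unitCell d, partialDeriv i f y * g y := by
  have h := integral_partialDeriv_eq_zero (hf.mul hg) (fun y k => by simp [hfp y k, hgp y k]) i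
  simp_rw [partialDeriv_mul hf hg] at h
  rw [integral_add] at h
  · linarith
  · exact (hf.continuous.mul (continuous_partialDeriv hg i)).integrableOn_unitCell
  · exact ((continuous_partialDeriv hf i).mul hg.continuous).integrableOn_unitCell

lemma LatticePeriodic.exists_mem_unitCell {F : Type*} {f : (Fin d → ℝ) → F}
    (hp : LatticePeriodic f) (y : Fin d → ℝ) : ∃ x ∈ unitCell d, f x = f y := by
  refine ⟨fun i => Int.fract (y i), fun i _ => ⟨Int.fract_nonneg _, (Int.fract_lt_one _).le⟩, ?_⟩
  rw [← hp _ fun i => ⌊y i⌋]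
  congr 1
  ext i
  simp

lemma LatticePeriodic.exists_abs_le {f : (Fin d → ℝ) → ℝ} (hf : Continuous f)
    (hp : LatticePeriodic f) : ∃ B, 0 ≤ B ∧ ∀ y, |f y| ≤ B := by
  obtain ⟨B, hB⟩ := isCompact_unitCell.exists_bound_of_continuousOn hf.continuousOn
  refine ⟨max B 0, le_max_right _ _, fun y => ?_⟩
  obtain ⟨x, hx, hxy⟩ := hp.exists_mem_unitCell y
  rw [← hxy]
  exact (hB x hx).trans (le_max_left _ _)

/-- A cube of side `2n` is covered by `(2n)^d` translates of the unit cell. -/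
lemma setIntegral_Icc_le_of_latticePeriodic {f : (Fin d → ℝ) → ℝ} (hf : Continuous f)
    (hp : LatticePeriodic f) (h0 : ∀ y, 0 ≤ f y) (n : ℕ) :
    ∫ y in Set.Icc (fun _ => -(n : ℝ)) (fun _ => (n : ℝ)), f y
      ≤ (2 * n : ℝ) ^ d * ∫ y in unitCell d, f y := by
  classical
  set T : Finset (Fin d → ℤ) := Fintype.piFinset fun _ => Finset.Ico (-(n : ℤ)) n
  have hcell : ∀ k : Fin d → ℤ,
      ∫ y in (fun x => x + fun i => (k i : ℝ)) '' unitCell d, f y = ∫ y in unitCell d, f y := by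
    intro k
    rw [(measurePreserving_add_right (volume : Measure (Fin d → ℝ))
      (fun i => (k i : ℝ))).setIntegral_image_emb
      (MeasurableEquiv.addRight fun i => (k i : ℝ)).measurableEmbedding f]
    simp_rw [hp _ k]
  have hcompact : ∀ k : Fin d → ℤ, IsCompact ((fun x => x + fun i => (k i : ℝ)) '' unitCell d) :=
    fun k => isCompact_unitCell.image (by fun_prop)
  have hcover : (Set.univ.pi fun _ : Fin d => Set.Ico (-(n : ℝ)) n) ⊆
      ⋃ k ∈ T, (fun x => x + fun i => (k i : ℝ)) '' unitCell d := by
    intro y hy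
    simp only [Set.mem_iUnion]
    refine ⟨fun i => ⌊y i⌋, ?_, fun i => Int.fract (y i),
      fun i _ => ⟨Int.fract_nonneg _, (Int.fract_lt_one _).le⟩, ?_⟩
    · rw [Fintype.mem_piFinset]
      intro i
      have := hy i trivial
      rw [Finset.mem_Ico, Int.le_floor, Int.floor_lt]
      exact ⟨by push_cast; exact this.1, by push_cast; exact this.2⟩
    · ext i; simp
  have hUint : IntegrableOn f (⋃ k ∈ T, (fun x => x + fun i => (k i : ℝ)) '' unitCell d) := by
    rw [integrableOn_finset_iUnion]
    exact fun k _ => hf.continuousOn.integrableOn_compact (hcompact k)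
  calc ∫ y in Set.Icc (fun _ => -(n : ℝ)) (fun _ => (n : ℝ)), f y
      = ∫ y in Set.univ.pi fun _ : Fin d => Set.Ico (-(n : ℝ)) n, f y :=
        (setIntegral_congr_set Measure.univ_pi_Ico_ae_eq_Icc).symm
    _ ≤ ∫ y in ⋃ k ∈ T, (fun x => x + fun i => (k i : ℝ)) '' unitCell d, f y :=
        setIntegral_mono_set hUint (ae_of_all _ h0) hcover.eventuallyLE
    _ ≤ ∑ k ∈ T, ∫ y in (fun x => x + fun i => (k i : ℝ)) '' unitCell d, f y := by
        have hU := fun k => hf.continuousOn.integrableOn_compact (μ := volume) (hcompact k)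
        clear hcover hUint
        induction T using Finset.induction_on with
        | empty => simp
        | insert a s ha ih =>
          rw [Finset.sum_insert ha, Finset.set_biUnion_insert]
          have hs : IntegrableOn f (⋃ k ∈ s, (fun x => x + fun i => (k i : ℝ)) '' unitCell d) := by
            rw [integrableOn_finset_iUnion]
            exact fun k _ => hU k
          refine (integral_mono_measure (Measure.restrict_union_le _ _) (ae_of_all _ h0)
            (Integrable.add_measure (hU a) hs)).trans ?_
          rw [integral_add_measure (hU a) hs]
          gcongr
    _ = (2 * n : ℝ) ^ d * ∫ y in unitCell d, f y := by
        simp_rw [hcell]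
        rw [Finset.sum_const, nsmul_eq_mul]
        congr 1
        simp only [T, Fintype.card_piFinset, Int.card_Ico, Finset.prod_const, Finset.card_univ,
          Fintype.card_fin]
        push_cast
        congr 1
        rw [show ((n : ℤ) - -n).toNat = 2 * n by omega]
        push_cast
        ring

end Cell

/-- Cauchy–Schwarz inequality for real-valued integrals. -/
lemma sq_integral_mul_le {α : Type*} [MeasurableSpace α] {μ : Measure α} {a b : α → ℝ}
    (ha : Integrable (fun x => a x ^ 2) μ) (hb : Integrable (fun x => b x ^ 2) μ)
    (hab : Integrable (fun x => a x * b x) μ) :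
    (∫ x, a x * b x ∂μ) ^ 2 ≤ (∫ x, a x ^ 2 ∂μ) * ∫ x, b x ^ 2 ∂μ := by
  have h : ∀ t : ℝ, 0 ≤ (∫ x, a x ^ 2 ∂μ) * (t * t) + (2 * ∫ x, a x * b x ∂μ) * t
      + ∫ x, b x ^ 2 ∂μ := by
    intro t
    have h1 : ∫ x, (a x * t + b x) ^ 2 ∂μ = (∫ x, a x ^ 2 ∂μ) * (t * t)
        + (2 * ∫ x, a x * b x ∂μ) * t + ∫ x, b x ^ 2 ∂μ := by
      have : ∀ x, (a x * t + b x) ^ 2 = a x ^ 2 * (t * t) + a x * b x * (2 * t) + b x ^ 2 :=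
        fun x => by ring
      simp_rw [this]
      rw [integral_add (f := fun x => a x ^ 2 * (t * t) + a x * b x * (2 * t))
          ((ha.mul_const _).add (hab.mul_const _)) hb,
        integral_add (ha.mul_const _) (hab.mul_const _), integral_mul_const, integral_mul_const]
      ring
    rw [← h1]
    exact integral_nonneg fun x => sq_nonneg _
  have := discrim_le_zero h
  unfold discrim at this
  nlinarith

/-- Fubini's theorem for continuous functions on a product of compact sets. -/
lemma setIntegral_swap_of_isCompact {X Y : Type*} [TopologicalSpace X] [TopologicalSpace Y]
    [T2Space X] [T2Space Y] [SecondCountableTopology X] [SecondCountableTopology Y]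
    [MeasurableSpace X] [MeasurableSpace Y] [BorelSpace X] [BorelSpace Y]
    {μ : Measure X} {ν : Measure Y} [SFinite μ] [SFinite ν]
    [IsFiniteMeasureOnCompacts μ] [IsFiniteMeasureOnCompacts ν]
    [IsFiniteMeasureOnCompacts (μ.prod ν)]
    {s : Set X} {t : Set Y} (hs : IsCompact s)
    (ht : IsCompact t) {F : X → Y → ℝ} (hF : Continuous (Function.uncurry F)) :
    ∫ x in s, ∫ y in t, F x y ∂ν ∂μ = ∫ y in t, ∫ x in s, F x y ∂μ ∂ν := by
  apply integral_integral_swap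
  rw [Measure.prod_restrict]
  exact hF.continuousOn.integrableOn_compact (hs.prod ht)

section Poincare

variable {d : ℕ}

lemma sq_sum_mul_le_of_mem_unitCell {z : Fin d → ℝ} (hz : z ∈ unitCell d) (g : Fin d → ℝ) :
    (∑ i, z i * g i) ^ 2 ≤ d * ∑ i, g i ^ 2 := by
  refine (Finset.sum_mul_sq_le_sq_mul_sq _ _ _).trans ?_
  gcongr
  calc ∑ i, z i ^ 2 ≤ ∑ _i : Fin d, (1 : ℝ) := Finset.sum_le_sum fun i _ => by
        have := hz i trivial
        nlinarith [this.1, this.2]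
    _ = d := by simp

lemma fderiv_apply_eq_sum_partialDeriv (f : (Fin d → ℝ) → ℝ) (y z : Fin d → ℝ) :
    fderiv ℝ f y z = ∑ i, z i * partialDeriv i f y := by
  conv_lhs => rw [pi_eq_sum_univ' z]
  simp [partialDeriv, map_sum]

lemma sq_sub_le_integral_grad {f : (Fin d → ℝ) → ℝ} (hf : ContDiff ℝ 1 f) {z : Fin d → ℝ}
    (hz : z ∈ unitCell d) (y : Fin d → ℝ) :
    (f (y + z) - f y) ^ 2
      ≤ ∫ θ in Set.Icc (0 : ℝ) 1, d * ∑ i, partialDeriv i f (y + θ • z) ^ 2 := by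
  have hline : Continuous fun θ : ℝ => y + θ • z := by fun_prop
  have hg : Continuous fun θ : ℝ => ∑ i, z i * partialDeriv i f (y + θ • z) :=
    continuous_finsetSum _ fun i _ =>
      continuous_const.mul ((continuous_partialDeriv hf i).comp hline)
  have hFTC : f (y + z) - f y = ∫ θ in Set.Icc (0 : ℝ) 1, ∑ i, z i * partialDeriv i f (y + θ • z) := by
    rw [integral_Icc_eq_integral_Ioc, ← intervalIntegral.integral_of_le zero_le_one,
      intervalIntegral.integral_eq_sub_of_hasDerivAt (f := fun θ : ℝ => f (y + θ • z))]
    · simp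
    · intro θ _
      rw [← fderiv_apply_eq_sum_partialDeriv]
      refine (hf.differentiable one_ne_zero _).hasFDerivAt.comp_hasDerivAt θ ?_
      simpa using ((hasDerivAt_id θ).smul_const z).const_add y
    · exact hg.intervalIntegrable _ _
  have hon : ∀ {g : ℝ → ℝ}, Continuous g → IntegrableOn g (Set.Icc (0 : ℝ) 1) := fun hg =>
    hg.continuousOn.integrableOn_compact isCompact_Icc
  have hCS := sq_integral_mul_le (μ := volume.restrict (Set.Icc (0 : ℝ) 1)) (a := fun _ => 1)
    (hon continuous_const) (hon (hg.pow 2)) (hon (continuous_const.mul hg))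
  simp only [one_mul, one_pow, integral_const, smul_eq_mul, mul_one, measureReal_restrict_apply_univ,
    Real.volume_real_Icc, sub_zero, zero_le_one, sup_of_le_left] at hCS
  rw [hFTC]
  refine hCS.trans (setIntegral_mono (hon (hg.pow 2)) (hon ?_) fun θ =>
    sq_sum_mul_le_of_mem_unitCell hz _)
  exact continuous_const.mul (continuous_finsetSum _ fun i _ =>
    ((continuous_partialDeriv hf i).comp hline).pow 2)

/-- The Poincaré inequality for periodic functions of mean zero. -/
lemma poincare_unitCell {f : (Fin d → ℝ) → ℝ} (hf : ContDiff ℝ 1 f) (hp : LatticePeriodic f)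
    (hmean : ∫ y in unitCell d, f y = 0) :
    ∫ y in unitCell d, f y ^ 2 ≤ d * ∫ y in unitCell d, ∑ i, partialDeriv i f y ^ 2 := by
  set J := ∫ y in unitCell d, ∑ i, partialDeriv i f y ^ 2 with hJ
  have hc := hf.continuous
  have hgc : Continuous fun y => ∑ i, partialDeriv i f y ^ 2 :=
    continuous_finsetSum _ fun i _ => (continuous_partialDeriv hf i).pow 2
  have hgp : LatticePeriodic fun y => ∑ i, partialDeriv i f y ^ 2 := fun y k => by
    simp only [fun i => hp.partialDeriv i y k]
  have hbound : ∀ z ∈ unitCell d, ∫ y in unitCell d, (f (y + z) - f y) ^ 2 ≤ d * J := by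
    intro z hz
    have hcont : Continuous (Function.uncurry fun (y : Fin d → ℝ) (θ : ℝ) =>
        (d : ℝ) * ∑ i, partialDeriv i f (y + θ • z) ^ 2) :=
      continuous_const.mul (hgc.comp (by fun_prop :
        Continuous fun p : (Fin d → ℝ) × ℝ => p.1 + p.2 • z))
    calc ∫ y in unitCell d, (f (y + z) - f y) ^ 2
        ≤ ∫ y in unitCell d, ∫ θ in Set.Icc (0 : ℝ) 1,
            d * ∑ i, partialDeriv i f (y + θ • z) ^ 2 := by
          refine setIntegral_mono (Continuous.integrableOn_unitCell (by fun_prop))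
            (Continuous.integrableOn_unitCell ?_) fun y => sq_sub_le_integral_grad hf hz y
          exact continuous_parametric_integral_of_continuous hcont isCompact_Icc
      _ = ∫ θ in Set.Icc (0 : ℝ) 1, ∫ y in unitCell d,
            d * ∑ i, partialDeriv i f (y + θ • z) ^ 2 :=
          setIntegral_swap_of_isCompact isCompact_unitCell isCompact_Icc hcont
      _ = ∫ θ in Set.Icc (0 : ℝ) 1, d * J := by
          congr 1
          ext θ
          rw [integral_const_mul, setIntegral_unitCell_add hgp]
      _ = d * J := by simp
  have hexp : ∀ z, ∫ y in unitCell d, (f (y + z) - f y) ^ 2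
      = 2 * (∫ y in unitCell d, f y ^ 2) - 2 * ∫ y in unitCell d, f (y + z) * f y := by
    intro z
    have h1 : ∀ y, (f (y + z) - f y) ^ 2 = f (y + z) ^ 2 + f y ^ 2 - 2 * (f (y + z) * f y) :=
      fun y => by ring
    simp_rw [h1]
    have hz : Continuous fun y => f (y + z) := by fun_prop
    rw [integral_sub (f := fun y => f (y + z) ^ 2 + f y ^ 2)
      (g := fun y => 2 * (f (y + z) * f y))
      (Continuous.integrableOn_unitCell (by fun_prop))
      (Continuous.integrableOn_unitCell (by fun_prop)),
      integral_add (f := fun y => f (y + z) ^ 2) (g := fun y => f y ^ 2)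
      (Continuous.integrableOn_unitCell (by fun_prop))
      (Continuous.integrableOn_unitCell (by fun_prop)),
      integral_const_mul, setIntegral_unitCell_add (f := fun y => f y ^ 2) (fun y k => by
        simp only [hp y k])]
    ring
  have hcross : ∫ z in unitCell d, ∫ y in unitCell d, f (y + z) * f y = 0 := by
    rw [setIntegral_swap_of_isCompact isCompact_unitCell isCompact_unitCell
      (F := fun z y => f (y + z) * f y) (by unfold Function.uncurry; fun_prop)]
    have hinner : ∀ y, ∫ z in unitCell d, f (y + z) * f y = 0 := fun y => by
      simp_rw [integral_mul_const, add_comm y, setIntegral_unitCell_add hp, hmean, zero_mul]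
    simp [hinner]
  have hcc : Continuous fun z => ∫ y in unitCell d, f (y + z) * f y :=
    continuous_parametric_integral_of_continuous
      (f := fun z y => f (y + z) * f y) (by unfold Function.uncurry; fun_prop) isCompact_unitCell
  have htot : ∫ z in unitCell d, ∫ y in unitCell d, (f (y + z) - f y) ^ 2
      ≤ ∫ z in unitCell d, d * J := by
    refine setIntegral_mono_on ?_ continuous_const.integrableOn_unitCell
      measurableSet_unitCell hbound
    simp_rw [hexp]
    exact (continuous_const.sub (continuous_const.mul hcc)).integrableOn_unitCell
  simp_rw [hexp] at htot
  rw [integral_sub (g := fun z => 2 * ∫ y in unitCell d, f (y + z) * f y)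
    continuous_const.integrableOn_unitCell
    (continuous_const.mul hcc).integrableOn_unitCell, integral_const_mul, integral_const_mul,
    hcross] at htot
  simp only [setIntegral_const, volume_real_unitCell, smul_eq_mul] at htot
  have h0 : 0 ≤ ∫ y in unitCell d, f y ^ 2 := integral_nonneg fun y => sq_nonneg _
  linarith

end Poincare

lemma hasFDerivAt_setIntegral_of_isCompact {X Y : Type*} [NormedAddCommGroup X] [NormedSpace ℝ X]
    [ProperSpace X] [TopologicalSpace Y] [T2Space Y]
    [SecondCountableTopology Y] [MeasurableSpace Y] [BorelSpace Y] {ν : Measure Y}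
    [IsFiniteMeasureOnCompacts ν] {t : Set Y} (ht : IsCompact t) {F : X → Y → ℝ}
    {F' : X → Y → X →L[ℝ] ℝ} (hF : Continuous (Function.uncurry F))
    (hF' : Continuous (Function.uncurry F')) (hd : ∀ x y, HasFDerivAt (F · y) (F' x y) x) (x₀ : X) :
    HasFDerivAt (fun x => ∫ y in t, F x y ∂ν) (∫ y in t, F' x₀ y ∂ν) x₀ := by
  have hslice : ∀ x, Continuous (F x) := fun x => hF.comp (Continuous.prodMk_right x)
  have hslice' : ∀ x, Continuous (F' x) := fun x => hF'.comp (Continuous.prodMk_right x)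
  obtain ⟨B, hB⟩ := ((isCompact_closedBall x₀ (1 : ℝ)).prod ht).exists_bound_of_continuousOn
    hF'.continuousOn
  have : IsFiniteMeasure (ν.restrict t) := ⟨by simpa using ht.measure_lt_top⟩
  refine hasFDerivAt_integral_of_dominated_of_fderiv_le (s := Metric.ball x₀ 1)
    (bound := fun _ => B) (Metric.ball_mem_nhds x₀ one_pos)
    (Filter.Eventually.of_forall fun x =>
      ((hslice x).continuousOn.integrableOn_compact ht).aestronglyMeasurable)
    ((hslice x₀).continuousOn.integrableOn_compact ht)
    ((hslice' x₀).continuousOn.integrableOn_compact ht).aestronglyMeasurable ?_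
    (integrable_const B) (ae_of_all _ fun y x _ => hd x y)
  filter_upwards [ae_restrict_mem ht.measurableSet] with y hy x hx
  exact hB (x, y) ⟨Metric.ball_subset_closedBall hx, hy⟩

section SpaceTime

variable {d : ℕ}

/-- The `i`-th spatial derivative of a function of space and time. -/
noncomputable def spaceDeriv (i : Fin d) (f : (Fin d → ℝ) × ℝ → ℝ) (z : (Fin d → ℝ) × ℝ) : ℝ :=
  fderiv ℝ f z (Pi.single i 1, 0)

/-- The time derivative of a function of space and time. -/
noncomputable def timeDeriv (f : (Fin d → ℝ) × ℝ → ℝ) (z : (Fin d → ℝ) × ℝ) : ℝ :=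
  fderiv ℝ f z (0, 1)

lemma contDiff_spaceDeriv {f : (Fin d → ℝ) × ℝ → ℝ} (hf : ContDiff ℝ 2 f) (i : Fin d) :
    ContDiff ℝ 1 (spaceDeriv i f) :=
  (hf.fderiv_right (m := 1) (by norm_num)).clm_apply contDiff_const

lemma contDiff_timeDeriv {f : (Fin d → ℝ) × ℝ → ℝ} (hf : ContDiff ℝ 2 f) :
    ContDiff ℝ 1 (timeDeriv f) :=
  (hf.fderiv_right (m := 1) (by norm_num)).clm_apply contDiff_const

lemma continuous_spaceDeriv {f : (Fin d → ℝ) × ℝ → ℝ} (hf : ContDiff ℝ 1 f) (i : Fin d) :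
    Continuous (spaceDeriv i f) :=
  (hf.continuous_fderiv one_ne_zero).clm_apply continuous_const

lemma continuous_timeDeriv {f : (Fin d → ℝ) × ℝ → ℝ} (hf : ContDiff ℝ 1 f) :
    Continuous (timeDeriv f) :=
  (hf.continuous_fderiv one_ne_zero).clm_apply continuous_const

lemma partialDeriv_slice {f : (Fin d → ℝ) × ℝ → ℝ} (hf : ContDiff ℝ 1 f) (i : Fin d)
    (y : Fin d → ℝ) (s : ℝ) : partialDeriv i (fun x => f (x, s)) y = spaceDeriv i f (y, s) := by
  have h : HasFDerivAt (fun x => f (x, s)) _ y :=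
    (hf.differentiable one_ne_zero (y, s)).hasFDerivAt.comp y (hasFDerivAt_prodMk_left (𝕜 := ℝ) y s)
  simp [partialDeriv, h.fderiv, spaceDeriv]

lemma hasDerivAt_slice {f : (Fin d → ℝ) × ℝ → ℝ} (hf : ContDiff ℝ 1 f)
    (y : Fin d → ℝ) (s : ℝ) : HasDerivAt (fun r => f (y, r)) (timeDeriv f (y, s)) s := by
  exact (hf.differentiable one_ne_zero (y, s)).hasFDerivAt.comp_hasDerivAt s
    ((hasDerivAt_const s y).prodMk (hasDerivAt_id s))

lemma timeDeriv_spaceDeriv {f : (Fin d → ℝ) × ℝ → ℝ} (hf : ContDiff ℝ 2 f) (i : Fin d)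
    (z : (Fin d → ℝ) × ℝ) : timeDeriv (spaceDeriv i f) z = spaceDeriv i (timeDeriv f) z := by
  have hd : Differentiable ℝ (fderiv ℝ f) :=
    (hf.fderiv_right (m := 1) (by norm_num)).differentiable one_ne_zero
  have hsymm : IsSymmSndFDerivAt ℝ f z := hf.contDiffAt.isSymmSndFDerivAt (by simp)
  have h : ∀ a b : (Fin d → ℝ) × ℝ,
      fderiv ℝ (fun w => fderiv ℝ f w a) z b = fderiv ℝ (fderiv ℝ f) z b a := by
    intro a b
    rw [fderiv_clm_apply (hd z) (differentiableAt_const a)]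
    simp
  unfold timeDeriv spaceDeriv
  rw [h, h]
  exact hsymm _ _

lemma spaceDeriv_periodic {f : (Fin d → ℝ) × ℝ → ℝ} (hf : ContDiff ℝ 1 f)
    (hp : ∀ s, LatticePeriodic fun y => f (y, s)) (i : Fin d) (s : ℝ) :
    LatticePeriodic fun y => spaceDeriv i f (y, s) := by
  simp_rw [← partialDeriv_slice hf]
  exact (hp s).partialDeriv i

lemma timeDeriv_periodic {f : (Fin d → ℝ) × ℝ → ℝ} (hf : ContDiff ℝ 1 f)
    (hp : ∀ s, LatticePeriodic fun y => f (y, s)) (s : ℝ) :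
    LatticePeriodic fun y => timeDeriv f (y, s) := by
  intro y k
  simp only [← (hasDerivAt_slice hf _ s).deriv]
  congr 1
  ext r
  exact hp r y k

lemma hasDerivAt_setIntegral_unitCell {f : (Fin d → ℝ) × ℝ → ℝ} (hf : ContDiff ℝ 1 f) (s : ℝ) :
    HasDerivAt (fun r => ∫ y in unitCell d, f (y, r)) (∫ y in unitCell d, timeDeriv f (y, s)) s := by
  have hc : Continuous fun p : ℝ × (Fin d → ℝ) => timeDeriv f (p.2, p.1) :=
    (continuous_timeDeriv hf).comp (by fun_prop)
  have h := hasFDerivAt_setIntegral_of_isCompact (ν := volume) (isCompact_unitCell (d := d))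
    (F := fun r y => f (y, r))
    (F' := fun r y => ContinuousLinearMap.toSpanSingleton ℝ (timeDeriv f (y, r)))
    (by exact hf.continuous.comp (by fun_prop)) (by
      exact (ContinuousLinearMap.toSpanSingletonCLE (𝕜 := ℝ) (E := ℝ)).continuous.comp hc)
    (fun r y => (hasDerivAt_slice hf y r).hasFDerivAt) s
  have h2 := h.hasDerivAt
  rw [ContinuousLinearMap.integral_apply] at h2
  · simpa using h2
  · refine Continuous.continuousOn ?_ |>.integrableOn_compact isCompact_unitCell
    exact (ContinuousLinearMap.toSpanSingletonCLE (𝕜 := ℝ) (E := ℝ)).continuous.comp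
      (hc.comp (Continuous.prodMk_right s))

/-- Average in time of a function of space and time against a kernel. -/
noncomputable def timeAvg (κ : ℝ → ℝ) (f : (Fin d → ℝ) × ℝ → ℝ) (y : Fin d → ℝ) : ℝ :=
  ∫ s, κ s * f (y, s)

lemma timeAvg_eq_setIntegral (κ : ℝ → ℝ) (f : (Fin d → ℝ) × ℝ → ℝ) (y : Fin d → ℝ) :
    timeAvg κ f y = ∫ s in tsupport κ, κ s * f (y, s) :=
  (setIntegral_eq_integral_of_forall_compl_eq_zero fun s hs => by
    rw [image_eq_zero_of_notMem_tsupport hs, zero_mul]).symm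

lemma continuous_timeAvg {κ : ℝ → ℝ} (hκ : Continuous κ) (hs : HasCompactSupport κ)
    {f : (Fin d → ℝ) × ℝ → ℝ} (hf : Continuous f) : Continuous (timeAvg κ f) := by
  have : timeAvg κ f = fun y => ∫ s in tsupport κ, κ s * f (y, s) :=
    funext (timeAvg_eq_setIntegral κ f)
  rw [this]
  exact continuous_parametric_integral_of_continuous
    (f := fun y s => κ s * f (y, s)) (by unfold Function.uncurry; fun_prop) hs

lemma timeAvg_integrable {κ : ℝ → ℝ} (hκ : Continuous κ) (hs : HasCompactSupport κ)
    {f : (Fin d → ℝ) × ℝ → ℝ} (hf : Continuous f) (y : Fin d → ℝ) :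
    Integrable fun s => κ s * f (y, s) :=
  Continuous.integrable_of_hasCompactSupport (by fun_prop) hs.mul_right

lemma hasFDerivAt_timeAvg {κ : ℝ → ℝ} (hκ : Continuous κ) (hs : HasCompactSupport κ)
    {f : (Fin d → ℝ) × ℝ → ℝ} (hf : ContDiff ℝ 1 f) (y : Fin d → ℝ) :
    HasFDerivAt (timeAvg κ f) (∫ s in tsupport κ,
      κ s • (fderiv ℝ f (y, s)).comp (ContinuousLinearMap.inl ℝ (Fin d → ℝ) ℝ)) y := by
  have : timeAvg κ f = fun y => ∫ s in tsupport κ, κ s * f (y, s) :=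
    funext (timeAvg_eq_setIntegral κ f)
  rw [this]
  have hf' := hf.continuous_fderiv one_ne_zero
  have hfc := hf.continuous
  refine hasFDerivAt_setIntegral_of_isCompact hs (F := fun y s => κ s * f (y, s))
    (F' := fun y s => κ s • (fderiv ℝ f (y, s)).comp (ContinuousLinearMap.inl ℝ (Fin d → ℝ) ℝ))
    (by unfold Function.uncurry; fun_prop) ?_ (fun x s => ?_) y
  · unfold Function.uncurry
    exact (hκ.comp continuous_snd).smul (hf'.clm_comp continuous_const)
  · exact ((hf.differentiable one_ne_zero (x, s)).hasFDerivAt.comp x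
      (hasFDerivAt_prodMk_left x s)).const_mul (κ s)

lemma partialDeriv_timeAvg {κ : ℝ → ℝ} (hκ : Continuous κ) (hs : HasCompactSupport κ)
    {f : (Fin d → ℝ) × ℝ → ℝ} (hf : ContDiff ℝ 1 f) (i : Fin d) (y : Fin d → ℝ) :
    partialDeriv i (timeAvg κ f) y = timeAvg κ (spaceDeriv i f) y := by
  have hf' := hf.continuous_fderiv one_ne_zero
  unfold partialDeriv
  rw [(hasFDerivAt_timeAvg hκ hs hf y).fderiv, ContinuousLinearMap.integral_apply,
    timeAvg_eq_setIntegral]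
  · simp [spaceDeriv]
  · refine Continuous.continuousOn ?_ |>.integrableOn_compact hs
    exact hκ.smul ((hf'.comp (Continuous.prodMk_right y)).clm_comp continuous_const)

lemma contDiff_timeAvg {κ : ℝ → ℝ} (hκ : Continuous κ) (hs : HasCompactSupport κ)
    {f : (Fin d → ℝ) × ℝ → ℝ} (hf : ContDiff ℝ 1 f) : ContDiff ℝ 1 (timeAvg κ f) := by
  have hf' := hf.continuous_fderiv one_ne_zero
  rw [contDiff_one_iff_hasFDerivAt]
  refine ⟨_, ?_, hasFDerivAt_timeAvg hκ hs hf⟩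
  refine continuous_parametric_integral_of_continuous (f := fun y s => κ s •
    (fderiv ℝ f (y, s)).comp (ContinuousLinearMap.inl ℝ (Fin d → ℝ) ℝ)) ?_ hs
  exact (hκ.comp continuous_snd).smul (hf'.clm_comp continuous_const)

lemma timeAvg_periodic (κ : ℝ → ℝ) {f : (Fin d → ℝ) × ℝ → ℝ}
    (hp : ∀ s, LatticePeriodic fun y => f (y, s)) : LatticePeriodic (timeAvg κ f) := by
  intro y k
  unfold timeAvg
  congr 1
  ext s
  exact congrArg (κ s * ·) (hp s y k)

/-- Integration by parts in time. -/
lemma timeAvg_timeDeriv {κ : ℝ → ℝ} (hκ : ContDiff ℝ 1 κ) (hs : HasCompactSupport κ)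
    {f : (Fin d → ℝ) × ℝ → ℝ} (hf : ContDiff ℝ 1 f) (y : Fin d → ℝ) :
    timeAvg κ (timeDeriv f) y = -timeAvg (deriv κ) f y := by
  unfold timeAvg
  exact integral_mul_deriv_eq_deriv_mul_of_integrable
    (fun s _ => (hκ.differentiable one_ne_zero s).hasDerivAt)
    (fun s _ => hasDerivAt_slice hf y s)
    (timeAvg_integrable hκ.continuous hs (continuous_timeDeriv hf) y)
    (timeAvg_integrable (hκ.continuous_deriv le_rfl) hs.deriv hf.continuous y)
    (timeAvg_integrable hκ.continuous hs hf.continuous y)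

lemma timeAvg_finset_sum {ι : Type*} (t : Finset ι) {κ : ℝ → ℝ} (hκ : Continuous κ)
    (hs : HasCompactSupport κ) {f : ι → (Fin d → ℝ) × ℝ → ℝ} (hf : ∀ i ∈ t, Continuous (f i))
    (y : Fin d → ℝ) : timeAvg κ (fun z => ∑ i ∈ t, f i z) y = ∑ i ∈ t, timeAvg κ (f i) y := by
  unfold timeAvg
  simp_rw [Finset.mul_sum]
  exact integral_finsetSum _ fun i hi => timeAvg_integrable hκ hs (hf i hi) y

/-- Mean-square bound for time averages. -/
lemma setIntegral_timeAvg_sq_le {κ : ℝ → ℝ} (hκ : Continuous κ) (hs : HasCompactSupport κ)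
    {f : (Fin d → ℝ) × ℝ → ℝ} (hf : Continuous f) {E : ℝ}
    (hE : ∀ s, ∫ y in unitCell d, f (y, s) ^ 2 ≤ E) :
    ∫ y in unitCell d, timeAvg κ f y ^ 2 ≤ (∫ s, |κ s|) ^ 2 * E := by
  have hpt : ∀ y, timeAvg κ f y ^ 2
      ≤ (∫ s, |κ s|) * ∫ s in tsupport κ, |κ s| * f (y, s) ^ 2 := by
    intro y
    have h1 : |timeAvg κ f y| ≤ ∫ s, √|κ s| * (√|κ s| * |f (y, s)|) := by
      refine (abs_integral_le_integral_abs).trans_eq ?_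
      congr 1
      ext s
      rw [← mul_assoc, Real.mul_self_sqrt (abs_nonneg _), abs_mul]
    have e1 : ∀ s, √|κ s| ^ 2 = |κ s| := fun s => Real.sq_sqrt (abs_nonneg _)
    have e2 : ∀ s, (√|κ s| * |f (y, s)|) ^ 2 = |κ s| * f (y, s) ^ 2 := fun s => by
      rw [mul_pow, e1, sq_abs]
    have hsa : HasCompactSupport fun s => |κ s| := hs.norm
    have hsr : HasCompactSupport fun s => √|κ s| := hsa.comp_left Real.sqrt_zero
    have h2 := sq_integral_mul_le (μ := volume) (a := fun s => √|κ s|)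
      (b := fun s => √|κ s| * |f (y, s)|)
      (by simp_rw [e1]; exact hκ.abs.integrable_of_hasCompactSupport hsa)
      (by
        simp_rw [e2]
        exact Continuous.integrable_of_hasCompactSupport (by fun_prop) hsa.mul_right)
      (Continuous.integrable_of_hasCompactSupport (by fun_prop) hsr.mul_right)
    simp_rw [e1, e2] at h2
    rw [setIntegral_eq_integral_of_forall_compl_eq_zero (fun s hs => by
      rw [image_eq_zero_of_notMem_tsupport hs]; simp)]
    refine le_trans ?_ h2
    rw [← sq_abs]
    gcongr
  have hc : Continuous (Function.uncurry fun (y : Fin d → ℝ) s => |κ s| * f (y, s) ^ 2) := by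
    unfold Function.uncurry; fun_prop
  have hnorm : ∫ s in tsupport κ, |κ s| = ∫ s, |κ s| :=
    setIntegral_eq_integral_of_forall_compl_eq_zero fun s hs => by
      rw [image_eq_zero_of_notMem_tsupport hs, abs_zero]
  have hts : IsCompact (tsupport κ) := hs
  calc ∫ y in unitCell d, timeAvg κ f y ^ 2
      ≤ ∫ y in unitCell d, (∫ s, |κ s|) * ∫ s in tsupport κ, |κ s| * f (y, s) ^ 2 := by
        refine setIntegral_mono ((continuous_timeAvg hκ hs hf).pow 2).integrableOn_unitCell
          (Continuous.integrableOn_unitCell ?_) hpt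
        exact continuous_const.mul (continuous_parametric_integral_of_continuous hc hts)
    _ = (∫ s, |κ s|) * ∫ s in tsupport κ, |κ s| * ∫ y in unitCell d, f (y, s) ^ 2 := by
        rw [integral_const_mul, setIntegral_swap_of_isCompact isCompact_unitCell hts hc]
        simp_rw [integral_const_mul]
    _ ≤ (∫ s, |κ s|) * ∫ s in tsupport κ, |κ s| * E := by
        refine mul_le_mul_of_nonneg_left ?_ (integral_nonneg fun s => abs_nonneg _)
        have hc2 : Continuous fun s => ∫ y in unitCell d, f (y, s) ^ 2 :=
          continuous_parametric_integral_of_continuous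
            (f := fun s y => f (y, s) ^ 2) (by unfold Function.uncurry; fun_prop)
            isCompact_unitCell
        refine setIntegral_mono ?_ ?_ fun s =>
          mul_le_mul_of_nonneg_left (hE s) (abs_nonneg _)
        · exact (hκ.abs.mul hc2).continuousOn.integrableOn_compact hts
        · exact (hκ.abs.mul continuous_const).continuousOn.integrableOn_compact hts
    _ = (∫ s, |κ s|) ^ 2 * E := by
        rw [integral_mul_const, hnorm]; ring

end SpaceTime

section Wave

variable {d : ℕ}

/-- Periodic, symmetric, uniformly elliptic and bounded `C¹` coefficients. -/
structure IsEllipticCoeff (A : (Fin d → ℝ) → Matrix (Fin d) (Fin d) ℝ) (m Λ : ℝ) : Prop where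
  contDiff : ∀ i j, ContDiff ℝ 1 fun y => A y i j
  periodic : LatticePeriodic A
  symm : ∀ y i j, A y i j = A y j i
  pos : 0 < m
  coercive : ∀ (y ξ : Fin d → ℝ), m * ∑ i, ξ i ^ 2 ≤ ∑ i, ξ i * ∑ j, A y i j * ξ j
  bound_nonneg : 0 ≤ Λ
  bound : ∀ (y ξ : Fin d → ℝ), ∑ i, (∑ j, A y i j * ξ j) ^ 2 ≤ Λ * ∑ i, ξ i ^ 2

/-- The `i`-th component of the flux `A∇v`. -/
noncomputable def flux (A : (Fin d → ℝ) → Matrix (Fin d) (Fin d) ℝ) (i : Fin d)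
    (v : (Fin d → ℝ) × ℝ → ℝ) (z : (Fin d → ℝ) × ℝ) : ℝ :=
  ∑ j, A z.1 i j * spaceDeriv j v z

/-- Twice continuously differentiable periodic solutions of `∂ₜ²v = ∇·(A∇v)` starting at rest. -/
structure IsPeriodicWave (A : (Fin d → ℝ) → Matrix (Fin d) (Fin d) ℝ)
    (v : (Fin d → ℝ) × ℝ → ℝ) : Prop where
  contDiff : ContDiff ℝ 2 v
  periodic : ∀ s, LatticePeriodic fun y => v (y, s)
  wave : ∀ z, timeDeriv (timeDeriv v) z = ∑ i, spaceDeriv i (flux A i v) z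
  velocity : ∀ y, timeDeriv v (y, 0) = 0

variable {A : (Fin d → ℝ) → Matrix (Fin d) (Fin d) ℝ} {m Λ : ℝ} {v : (Fin d → ℝ) × ℝ → ℝ}

lemma IsEllipticCoeff.contDiff_flux (hA : IsEllipticCoeff A m Λ) (hv : ContDiff ℝ 2 v)
    (i : Fin d) : ContDiff ℝ 1 (flux A i v) :=
  ContDiff.sum fun j _ => ((hA.contDiff i j).comp contDiff_fst).mul (contDiff_spaceDeriv hv j)

lemma IsEllipticCoeff.flux_periodic (hA : IsEllipticCoeff A m Λ) (hv : IsPeriodicWave A v)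
    (i : Fin d) (s : ℝ) : LatticePeriodic fun y => flux A i v (y, s) := by
  intro y k
  have h := fun j => spaceDeriv_periodic (hv.contDiff.of_le (by norm_num)) hv.periodic j s y k
  simp only at h
  simp only [flux, hA.periodic y k, h]

/-- The energy density of a wave. -/
noncomputable def energyDensity (A : (Fin d → ℝ) → Matrix (Fin d) (Fin d) ℝ)
    (v : (Fin d → ℝ) × ℝ → ℝ) (z : (Fin d → ℝ) × ℝ) : ℝ :=
  timeDeriv v z ^ 2 + ∑ i, spaceDeriv i v z * flux A i v z

lemma IsEllipticCoeff.contDiff_energyDensity (hA : IsEllipticCoeff A m Λ) (hv : ContDiff ℝ 2 v) :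
    ContDiff ℝ 1 (energyDensity A v) :=
  ((contDiff_timeDeriv hv).pow 2).add
    (ContDiff.sum fun i _ => (contDiff_spaceDeriv hv i).mul (hA.contDiff_flux hv i))

lemma IsEllipticCoeff.sum_sq_spaceDeriv_le (hA : IsEllipticCoeff A m Λ)
    (z : (Fin d → ℝ) × ℝ) : m * ∑ i, spaceDeriv i v z ^ 2 ≤ energyDensity A v z := by
  have := hA.coercive z.1 fun i => spaceDeriv i v z
  unfold energyDensity flux
  nlinarith [sq_nonneg (timeDeriv v z)]

lemma IsEllipticCoeff.sq_timeDeriv_le (hA : IsEllipticCoeff A m Λ)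
    (z : (Fin d → ℝ) × ℝ) : timeDeriv v z ^ 2 ≤ energyDensity A v z := by
  have := hA.coercive z.1 fun i => spaceDeriv i v z
  have h0 : 0 ≤ m * ∑ i, spaceDeriv i v z ^ 2 :=
    mul_nonneg hA.pos.le (Finset.sum_nonneg fun i _ => sq_nonneg _)
  unfold energyDensity flux
  linarith

lemma IsEllipticCoeff.sum_sq_flux_le (hA : IsEllipticCoeff A m Λ)
    (z : (Fin d → ℝ) × ℝ) : ∑ i, flux A i v z ^ 2 ≤ Λ / m * energyDensity A v z := by
  have h1 := hA.bound z.1 fun i => spaceDeriv i v z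
  have h2 := mul_le_mul_of_nonneg_left (hA.sum_sq_spaceDeriv_le (v := v) z)
    (div_nonneg hA.bound_nonneg hA.pos.le)
  refine h1.trans (le_trans (le_of_eq ?_) h2)
  have := hA.pos.ne'
  field_simp

lemma timeDeriv_eq_of_hasDerivAt {f : (Fin d → ℝ) × ℝ → ℝ} (hf : ContDiff ℝ 1 f)
    {y : Fin d → ℝ} {s c : ℝ} (h : HasDerivAt (fun r => f (y, r)) c s) : timeDeriv f (y, s) = c :=
  (hasDerivAt_slice hf y s).unique h

lemma IsEllipticCoeff.timeDeriv_energyDensity (hA : IsEllipticCoeff A m Λ)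
    (hv : IsPeriodicWave A v) (y : Fin d → ℝ) (s : ℝ) :
    timeDeriv (energyDensity A v) (y, s) = 2 * ∑ i,
      (timeDeriv v (y, s) * spaceDeriv i (flux A i v) (y, s)
        + spaceDeriv i (timeDeriv v) (y, s) * flux A i v (y, s)) := by
  have hD : ∀ i, HasDerivAt (fun r => spaceDeriv i v (y, r))
      (spaceDeriv i (timeDeriv v) (y, s)) s := fun i => by
    rw [← timeDeriv_spaceDeriv hv.contDiff]
    exact hasDerivAt_slice (contDiff_spaceDeriv hv.contDiff i) y s
  have hF : ∀ i, HasDerivAt (fun r => flux A i v (y, r))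
      (∑ j, A y i j * spaceDeriv j (timeDeriv v) (y, s)) s := fun i =>
    HasDerivAt.fun_sum fun j _ => (hD j).const_mul (A y i j)
  have h := ((hasDerivAt_slice (contDiff_timeDeriv hv.contDiff) y s).fun_pow 2).fun_add
    (HasDerivAt.fun_sum (u := Finset.univ) fun i _ => (hD i).fun_mul (hF i))
  refine (timeDeriv_eq_of_hasDerivAt (hA.contDiff_energyDensity hv.contDiff) h).trans ?_
  rw [hv.wave, Finset.sum_add_distrib, Finset.sum_add_distrib, ← Finset.mul_sum]
  have hsym : ∑ i, spaceDeriv i v (y, s) * ∑ j, A y i j * spaceDeriv j (timeDeriv v) (y, s)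
      = ∑ i, spaceDeriv i (timeDeriv v) (y, s) * flux A i v (y, s) := by
    simp_rw [flux, Finset.mul_sum]
    rw [Finset.sum_comm]
    refine Finset.sum_congr rfl fun i _ => Finset.sum_congr rfl fun j _ => ?_
    rw [hA.symm y j i]
    ring
  rw [hsym]
  simp only [Nat.cast_ofNat, Nat.add_one_sub_one, pow_one]
  ring

/-- A nonnegative periodic weight whose logarithmic gradient is at most `δ`. -/
structure IsSlowWeight (ρ : (Fin d → ℝ) → ℝ) (δ : ℝ) : Prop where
  contDiff : ContDiff ℝ 1 ρ
  periodic : LatticePeriodic ρ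
  nonneg : ∀ y, 0 ≤ ρ y
  rate_nonneg : 0 ≤ δ
  grad_le : ∀ i y, |partialDeriv i ρ y| ≤ δ * ρ y

variable {ρ : (Fin d → ℝ) → ℝ} {δ : ℝ}

/-- The weighted energy changes at a rate controlled by the logarithmic gradient of the weight. -/
lemma IsEllipticCoeff.exists_hasDerivAt_energy (hA : IsEllipticCoeff A m Λ)
    (hv : IsPeriodicWave A v) (hρ : IsSlowWeight ρ δ) (s : ℝ) :
    ∃ e, HasDerivAt (fun r => ∫ y in unitCell d, ρ y * energyDensity A v (y, r)) e s ∧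
      |e| ≤ (d + Λ / m) * δ * ∫ y in unitCell d, ρ y * energyDensity A v (y, s) := by
  have hv1 : ContDiff ℝ 1 v := hv.contDiff.of_le (by norm_num)
  have hE := hA.contDiff_energyDensity hv.contDiff
  have hρE : ContDiff ℝ 1 fun z : (Fin d → ℝ) × ℝ => ρ z.1 * energyDensity A v z :=
    (hρ.contDiff.comp contDiff_fst).mul hE
  have hpair : ContDiff ℝ 1 fun y : Fin d → ℝ => (y, s) := contDiff_id.prodMk contDiff_const
  have hvt := contDiff_timeDeriv hv.contDiff
  have hfl := hA.contDiff_flux hv.contDiff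
  have hprod : ∀ i, ContDiff ℝ 1 fun y => timeDeriv v (y, s) * flux A i v (y, s) := fun i =>
    (hvt.comp hpair).mul ((hfl i).comp hpair)
  have hprodp : ∀ i, LatticePeriodic fun y => timeDeriv v (y, s) * flux A i v (y, s) := by
    intro i y k
    have h1 := timeDeriv_periodic hv1 hv.periodic s y k
    have h2 := hA.flux_periodic hv i s y k
    simp only at h1 h2 ⊢
    rw [h1, h2]
  refine ⟨_, hasDerivAt_setIntegral_unitCell hρE s, ?_⟩
  have hpt : ∀ y, timeDeriv (fun z : (Fin d → ℝ) × ℝ => ρ z.1 * energyDensity A v z) (y, s)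
      = ∑ i, 2 * (ρ y * partialDeriv i (fun x => timeDeriv v (x, s) * flux A i v (x, s)) y) := by
    intro y
    rw [timeDeriv_eq_of_hasDerivAt hρE ((hasDerivAt_slice hE y s).const_mul (ρ y)),
      hA.timeDeriv_energyDensity hv, Finset.mul_sum, Finset.mul_sum]
    refine Finset.sum_congr rfl fun i _ => ?_
    rw [partialDeriv_mul (f := fun x => timeDeriv v (x, s)) (g := fun x => flux A i v (x, s))
      (hvt.comp hpair) ((hfl i).comp hpair), partialDeriv_slice hvt, partialDeriv_slice (hfl i)]
    ring
  have hpc : ∀ i, Continuous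
      (partialDeriv i fun x => timeDeriv v (x, s) * flux A i v (x, s)) := fun i =>
    continuous_partialDeriv (hprod i) i
  have hρc := hρ.contDiff.continuous
  have hval : ∫ y in unitCell d,
      timeDeriv (fun z : (Fin d → ℝ) × ℝ => ρ z.1 * energyDensity A v z) (y, s)
      = ∫ y in unitCell d, -(2 * ∑ i, partialDeriv i ρ y *
          (timeDeriv v (y, s) * flux A i v (y, s))) := by
    simp_rw [hpt]
    rw [integral_finsetSum (f := fun i y => 2 * (ρ y * partialDeriv i
        (fun x => timeDeriv v (x, s) * flux A i v (x, s)) y)) _ fun i _ =>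
      ((continuous_const.mul (hρc.mul (hpc i))).integrableOn_unitCell)]
    simp_rw [integral_const_mul]
    rw [integral_neg, integral_const_mul, integral_finsetSum
      (f := fun i y => partialDeriv i ρ y * (timeDeriv v (y, s) * flux A i v (y, s))) _ fun i _ =>
      ((continuous_partialDeriv hρ.contDiff i).mul (hprod i).continuous).integrableOn_unitCell,
      Finset.mul_sum, ← Finset.sum_neg_distrib]
    refine Finset.sum_congr rfl fun i _ => ?_
    rw [integral_mul_partialDeriv hρ.contDiff (hprod i) hρ.periodic (hprodp i) i]
    simp
  rw [hval, ← integral_const_mul]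
  have hEc : Continuous fun y => energyDensity A v (y, s) := hE.continuous.comp hpair.continuous
  refine (abs_integral_le_integral_abs).trans (setIntegral_mono
    (Continuous.integrableOn_unitCell ?_) (Continuous.integrableOn_unitCell ?_) fun y => ?_)
  · exact (continuous_const.mul (continuous_finsetSum _ fun i _ =>
      (continuous_partialDeriv hρ.contDiff i).mul (hprod i).continuous)).neg.abs
  · exact continuous_const.mul (hρc.mul hEc)
  · have h1 : ∀ i, |partialDeriv i ρ y * (timeDeriv v (y, s) * flux A i v (y, s))|
        ≤ δ * ρ y * ((timeDeriv v (y, s) ^ 2 + flux A i v (y, s) ^ 2) / 2) := by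
      intro i
      rw [abs_mul]
      refine mul_le_mul (hρ.grad_le i y) ?_ (abs_nonneg _)
        (mul_nonneg hρ.rate_nonneg (hρ.nonneg y))
      rw [abs_le]
      constructor <;>
        nlinarith [sq_nonneg (timeDeriv v (y, s) + flux A i v (y, s)),
          sq_nonneg (timeDeriv v (y, s) - flux A i v (y, s))]
    have h2 : |∑ i, partialDeriv i ρ y * (timeDeriv v (y, s) * flux A i v (y, s))|
        ≤ δ * ρ y / 2 * (d * timeDeriv v (y, s) ^ 2 + ∑ i, flux A i v (y, s) ^ 2) := by
      refine (Finset.abs_sum_le_sum_abs _ _).trans ((Finset.sum_le_sum fun i _ => h1 i).trans_eq ?_)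
      rw [← Finset.mul_sum, ← Finset.sum_div, Finset.sum_add_distrib]
      simp only [Finset.sum_const, Finset.card_univ, Fintype.card_fin, nsmul_eq_mul]
      ring
    have h3 : d * timeDeriv v (y, s) ^ 2 + ∑ i, flux A i v (y, s) ^ 2
        ≤ (d + Λ / m) * energyDensity A v (y, s) := by
      rw [add_mul]
      exact add_le_add (mul_le_mul_of_nonneg_left (hA.sq_timeDeriv_le _) (Nat.cast_nonneg d))
        (hA.sum_sq_flux_le _)
    have h4 := mul_le_mul_of_nonneg_left h3 (mul_nonneg hρ.rate_nonneg (hρ.nonneg y))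
    rw [abs_neg, abs_mul, abs_two]
    linarith

/-- Growth bound for the weighted energy. -/
lemma IsEllipticCoeff.energy_le (hA : IsEllipticCoeff A m Λ)
    (hv : IsPeriodicWave A v) (hρ : IsSlowWeight ρ δ) (s : ℝ) :
    ∫ y in unitCell d, ρ y * energyDensity A v (y, s)
      ≤ Real.exp ((d + Λ / m) * δ * |s|) * ∫ y in unitCell d, ρ y * energyDensity A v (y, 0) := by
  choose e he hle using hA.exists_hasDerivAt_energy hv hρ
  set E : ℝ → ℝ := fun r => ∫ y in unitCell d, ρ y * energyDensity A v (y, r)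
  set c := (d + Λ / m) * δ
  have hexp : ∀ a r : ℝ, HasDerivAt (fun r => Real.exp (a * r)) (Real.exp (a * r) * a) r :=
    fun a r => by simpa using ((hasDerivAt_id r).const_mul a).exp
  rcases le_total 0 s with hs | hs
  · have hanti : Antitone fun r => Real.exp (-c * r) * E r := by
      refine antitone_of_hasDerivAt_nonpos (fun r => (hexp (-c) r).fun_mul (he r)) fun r => ?_
      have := (abs_le.1 (hle r)).2
      have hE : e r ≤ c * E r := this
      have := Real.exp_pos (-c * r)
      simp only [Pi.zero_apply]
      nlinarith
    have h := hanti hs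
    simp only [mul_zero, Real.exp_zero, one_mul] at h
    rw [abs_of_nonneg hs]
    calc E s = Real.exp (c * s) * (Real.exp (-c * s) * E s) := by
          rw [← mul_assoc, ← Real.exp_add]; simp
      _ ≤ Real.exp (c * s) * E 0 := by gcongr
  · have hmono : Monotone fun r => Real.exp (c * r) * E r := by
      refine monotone_of_hasDerivAt_nonneg (fun r => (hexp c r).fun_mul (he r)) fun r => ?_
      have := (abs_le.1 (hle r)).1
      have hE : -(c * E r) ≤ e r := this
      have := Real.exp_pos (c * r)
      simp only [Pi.zero_apply]
      nlinarith
    have h := hmono hs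
    simp only [mul_zero, Real.exp_zero, one_mul] at h
    rw [abs_of_nonpos hs]
    calc E s = Real.exp (c * -s) * (Real.exp (c * s) * E s) := by
          rw [← mul_assoc, ← Real.exp_add]; simp
      _ ≤ Real.exp (c * -s) * E 0 := by gcongr

lemma isSlowWeight_one : IsSlowWeight (fun _ : Fin d → ℝ => (1 : ℝ)) 0 where
  contDiff := contDiff_const
  periodic _ _ := rfl
  nonneg _ := zero_le_one
  rate_nonneg := le_rfl
  grad_le i y := by simp [partialDeriv]

lemma IsEllipticCoeff.energy_le_initial (hA : IsEllipticCoeff A m Λ) (hv : IsPeriodicWave A v)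
    (s : ℝ) : ∫ y in unitCell d, energyDensity A v (y, s)
      ≤ ∫ y in unitCell d, energyDensity A v (y, 0) := by
  simpa using hA.energy_le hv isSlowWeight_one s

end Wave

section Decay

variable {d : ℕ} {A : (Fin d → ℝ) → Matrix (Fin d) (Fin d) ℝ} {m Λ : ℝ}
  {v : (Fin d → ℝ) × ℝ → ℝ} {κ : ℝ → ℝ}

lemma timeAvg_flux (hκ : Continuous κ) (hs : HasCompactSupport κ) (hv : ContDiff ℝ 1 v)
    (i : Fin d) (y : Fin d → ℝ) :
    timeAvg κ (flux A i v) y = ∑ j, A y i j * timeAvg κ (spaceDeriv j v) y := by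
  unfold timeAvg flux
  simp_rw [← integral_const_mul, Finset.mul_sum]
  rw [integral_finsetSum (f := fun j s => κ s * (A y i j * spaceDeriv j v (y, s)))]
  · refine Finset.sum_congr rfl fun j _ => ?_
    congr 1
    ext s
    ring
  · intro j _
    have := (timeAvg_integrable hκ hs (continuous_spaceDeriv hv j) y).const_mul (A y i j)
    refine this.congr (Filter.Eventually.of_forall fun s => ?_)
    ring

/-- The time-averaged wave equation. -/
lemma IsEllipticCoeff.sum_partialDeriv_timeAvg_flux (hA : IsEllipticCoeff A m Λ)
    (hv : IsPeriodicWave A v) (hκ : ContDiff ℝ 1 κ) (hs : HasCompactSupport κ) (y : Fin d → ℝ) :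
    ∑ i, partialDeriv i (timeAvg κ (flux A i v)) y = -timeAvg (deriv κ) (timeDeriv v) y := by
  have hfl := hA.contDiff_flux hv.contDiff
  simp_rw [fun i => partialDeriv_timeAvg hκ.continuous hs (hfl i) i y]
  rw [← timeAvg_finset_sum Finset.univ hκ.continuous hs
    (fun i _ => continuous_spaceDeriv (hfl i) i),
    ← timeAvg_timeDeriv hκ hs (contDiff_timeDeriv hv.contDiff)]
  congr 1
  ext z
  exact (hv.wave z).symm

lemma IsEllipticCoeff.integral_timeAvg_deriv_timeDeriv (hA : IsEllipticCoeff A m Λ)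
    (hv : IsPeriodicWave A v) (hκ : ContDiff ℝ 1 κ) (hs : HasCompactSupport κ) :
    ∫ y in unitCell d, timeAvg (deriv κ) (timeDeriv v) y = 0 := by
  have hG : ∀ i, ContDiff ℝ 1 (timeAvg κ (flux A i v)) := fun i =>
    contDiff_timeAvg hκ.continuous hs (hA.contDiff_flux hv.contDiff i)
  have h : ∀ y, timeAvg (deriv κ) (timeDeriv v) y
      = -∑ i, partialDeriv i (timeAvg κ (flux A i v)) y := fun y => by
    rw [hA.sum_partialDeriv_timeAvg_flux hv hκ hs, neg_neg]
  simp_rw [h]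
  rw [integral_neg, integral_finsetSum _ fun i _ =>
    (continuous_partialDeriv (hG i) i).integrableOn_unitCell]
  simp [fun i => integral_partialDeriv_eq_zero (hG i)
    (timeAvg_periodic κ (hA.flux_periodic hv i)) i]

/-- Elliptic estimate for the time-averaged wave. -/
lemma IsEllipticCoeff.integral_sq_gradient_timeAvg_le (hA : IsEllipticCoeff A m Λ)
    (hv : IsPeriodicWave A v) (hκ : ContDiff ℝ 1 κ) (hs : HasCompactSupport κ) :
    ∫ y in unitCell d, ∑ i, timeAvg κ (spaceDeriv i v) y ^ 2
      ≤ d / m ^ 2 * ∫ y in unitCell d, timeAvg (deriv κ) (timeDeriv v) y ^ 2 := by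
  have hv1 : ContDiff ℝ 1 v := hv.contDiff.of_le (by norm_num)
  have hκc := hκ.continuous
  set S := timeAvg κ v
  set G : Fin d → (Fin d → ℝ) → ℝ := fun i => timeAvg κ (flux A i v)
  set T := timeAvg (deriv κ) (timeDeriv v)
  set c := ∫ y in unitCell d, S y
  have hS : ContDiff ℝ 1 S := contDiff_timeAvg hκc hs hv1
  have hSp : LatticePeriodic S := timeAvg_periodic κ hv.periodic
  have hT : Continuous T :=
    continuous_timeAvg (hκ.continuous_deriv le_rfl) hs.deriv (continuous_timeDeriv hv1)
  have hG : ∀ i, ContDiff ℝ 1 (G i) := fun i =>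
    contDiff_timeAvg hκc hs (hA.contDiff_flux hv.contDiff i)
  have hGp : ∀ i, LatticePeriodic (G i) := fun i => timeAvg_periodic κ (hA.flux_periodic hv i)
  set S0 : (Fin d → ℝ) → ℝ := fun y => S y - c
  have hS0 : ContDiff ℝ 1 S0 := hS.sub contDiff_const
  have hS0p : LatticePeriodic S0 := fun y k => by simp only [S0, hSp y k]
  have hdS0 : ∀ i y, partialDeriv i S0 y = timeAvg κ (spaceDeriv i v) y := fun i y => by
    rw [← partialDeriv_timeAvg hκc hs hv1]
    simp [partialDeriv, S0, S, fderiv_sub_const]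
  have hmean : ∫ y in unitCell d, S0 y = 0 := by
    simp only [S0]
    rw [integral_sub hS.continuous.integrableOn_unitCell
      (continuous_const (y := c)).integrableOn_unitCell]
    simp [volume_real_unitCell, c]
  have hP := poincare_unitCell hS0 hS0p hmean
  simp_rw [hdS0] at hP
  set a := ∫ y in unitCell d, ∑ i, timeAvg κ (spaceDeriv i v) y ^ 2
  set b := ∫ y in unitCell d, T y ^ 2
  have hDc : ∀ i, Continuous (timeAvg κ (spaceDeriv i v)) := fun i =>
    continuous_timeAvg hκc hs (continuous_spaceDeriv hv1 i)
  have ha0 : 0 ≤ a := integral_nonneg fun y => Finset.sum_nonneg fun i _ => sq_nonneg _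
  have hb0 : 0 ≤ b := integral_nonneg fun y => sq_nonneg _
  have hcoer : m * a ≤ ∫ y in unitCell d, ∑ i, timeAvg κ (spaceDeriv i v) y * G i y := by
    rw [← integral_const_mul]
    refine setIntegral_mono (Continuous.integrableOn_unitCell ?_)
      (Continuous.integrableOn_unitCell ?_) fun y => ?_
    · exact continuous_const.mul (continuous_finsetSum _ fun i _ => (hDc i).pow 2)
    · exact continuous_finsetSum _ fun i _ => (hDc i).mul (hG i).continuous
    · simp only [G, timeAvg_flux hκc hs hv1]
      exact hA.coercive y fun i => timeAvg κ (spaceDeriv i v) y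
  have hparts : ∫ y in unitCell d, ∑ i, timeAvg κ (spaceDeriv i v) y * G i y
      = ∫ y in unitCell d, S0 y * T y := by
    have h1 : ∀ y, S0 y * T y = -∑ i, S0 y * partialDeriv i (G i) y := fun y => by
      rw [← Finset.mul_sum, hA.sum_partialDeriv_timeAvg_flux hv hκ hs]
      ring
    simp_rw [h1]
    rw [integral_neg, integral_finsetSum (f := fun i y => S0 y * partialDeriv i (G i) y),
      integral_finsetSum (f := fun i y => timeAvg κ (spaceDeriv i v) y * G i y),
      ← Finset.sum_neg_distrib]
    · refine Finset.sum_congr rfl fun i _ => ?_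
      rw [integral_mul_partialDeriv hS0 (hG i) hS0p (hGp i) i, neg_neg]
      simp_rw [hdS0]
    · exact fun i _ => ((hDc i).mul (hG i).continuous).integrableOn_unitCell
    · exact fun i _ => (hS0.continuous.mul (continuous_partialDeriv (hG i) i)).integrableOn_unitCell
  have hCS := sq_integral_mul_le (a := S0) (b := T) (hS0.continuous.pow 2).integrableOn_unitCell
    (hT.pow 2).integrableOn_unitCell (hS0.continuous.mul hT).integrableOn_unitCell
  have hm := hA.pos
  have hsq : (m * a) ^ 2 ≤ d * a * b := by
    rw [hparts] at hcoer
    calc (m * a) ^ 2 ≤ (∫ y in unitCell d, S0 y * T y) ^ 2 := by gcongr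
      _ ≤ _ := hCS
      _ ≤ d * a * b := by gcongr
  rw [div_mul_eq_mul_div, le_div_iff₀ (by positivity)]
  rcases ha0.eq_or_lt with h | h
  · rw [← h]
    simpa using by positivity
  · refine le_of_mul_le_mul_left ?_ h
    linarith

/-- Smooth time averages of the gradient of a wave are small. -/
lemma IsEllipticCoeff.exists_gradient_decay (hA : IsEllipticCoeff A m Λ) (n : ℕ) :
    ∃ C, 0 ≤ C ∧ ∀ v, IsPeriodicWave A v → ∀ κ : ℝ → ℝ, ContDiff ℝ n κ → HasCompactSupport κ →
      ∫ y in unitCell d, ∑ i, timeAvg κ (spaceDeriv i v) y ^ 2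
        ≤ C * (∫ s, |iteratedDeriv n κ s|) ^ 2 * ∫ y in unitCell d, energyDensity A v (y, 0) := by
  have hm := hA.pos
  have hslice : ∀ {g : (Fin d → ℝ) × ℝ → ℝ}, Continuous g → ∀ s, Continuous fun y => g (y, s) :=
    fun hg s => hg.comp (by fun_prop)
  induction n using Nat.twoStepInduction with
  | zero =>
    refine ⟨d / m, by positivity, fun v hv κ hκ hs => ?_⟩
    have hv1 : ContDiff ℝ 1 v := hv.contDiff.of_le (by norm_num)
    have hκc := hκ.continuous
    have hE := (hA.contDiff_energyDensity hv.contDiff).continuous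
    rw [integral_finsetSum _ fun i _ => Continuous.integrableOn_unitCell
      (f := fun y => timeAvg κ (spaceDeriv i v) y ^ 2)
      ((continuous_timeAvg hκc hs (continuous_spaceDeriv hv1 i)).pow 2)]
    have h1 : ∀ i : Fin d, ∀ s, ∫ y in unitCell d, spaceDeriv i v (y, s) ^ 2
        ≤ m⁻¹ * ∫ y in unitCell d, energyDensity A v (y, 0) := by
      intro i s
      refine le_trans ?_ (mul_le_mul_of_nonneg_left (hA.energy_le_initial hv s)
        (inv_nonneg.2 hm.le))
      rw [← integral_const_mul]
      refine setIntegral_mono ((hslice (continuous_spaceDeriv hv1 i) s).pow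
        2).integrableOn_unitCell (continuous_const.mul (hslice hE s)).integrableOn_unitCell
        fun y => ?_
      have h2 := hA.sum_sq_spaceDeriv_le (v := v) (y, s)
      have h3 := Finset.single_le_sum (f := fun i => spaceDeriv i v (y, s) ^ 2)
        (fun i _ => sq_nonneg _) (Finset.mem_univ i)
      simp only at h3 ⊢
      rw [← div_eq_inv_mul, le_div_iff₀ hm]
      nlinarith
    refine (Finset.sum_le_sum fun i _ => setIntegral_timeAvg_sq_le hκc hs
      (continuous_spaceDeriv hv1 i) (h1 i)).trans_eq ?_
    simp only [Finset.sum_const, Finset.card_univ, Fintype.card_fin, nsmul_eq_mul,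
      iteratedDeriv_zero]
    ring
  | one =>
    refine ⟨d / m ^ 2, by positivity, fun v hv κ hκ hs => ?_⟩
    have hv1 : ContDiff ℝ 1 v := hv.contDiff.of_le (by norm_num)
    have hκ1 : ContDiff ℝ 1 κ := by exact_mod_cast hκ
    have hE := (hA.contDiff_energyDensity hv.contDiff).continuous
    refine (hA.integral_sq_gradient_timeAvg_le hv hκ1 hs).trans ?_
    rw [mul_assoc, iteratedDeriv_one]
    refine mul_le_mul_of_nonneg_left ?_ (by positivity)
    refine setIntegral_timeAvg_sq_le (hκ1.continuous_deriv le_rfl) hs.deriv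
      (continuous_timeDeriv hv1) fun s => ?_
    refine le_trans ?_ (hA.energy_le_initial hv s)
    exact setIntegral_mono ((hslice (continuous_timeDeriv hv1) s).pow 2).integrableOn_unitCell
      (hslice hE s).integrableOn_unitCell fun y => hA.sq_timeDeriv_le (y, s)
  | more n ih _ =>
    obtain ⟨C, hC, h⟩ := ih
    refine ⟨d / m ^ 2 * d * C, by positivity, fun v hv κ hκ hs => ?_⟩
    have hv1 : ContDiff ℝ 1 v := hv.contDiff.of_le (by norm_num)
    have hκ1 : ContDiff ℝ 1 κ := hκ.of_le (by norm_cast; omega)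
    have hκ' : ContDiff ℝ (n + 1 : ℕ) (deriv κ) :=
      ((contDiff_succ_iff_deriv (n := (n + 1 : ℕ))).1 (by exact_mod_cast hκ)).2.2
    have hκ'' : ContDiff ℝ (n : ℕ) (deriv (deriv κ)) :=
      ((contDiff_succ_iff_deriv (n := (n : ℕ))).1 (by exact_mod_cast hκ')).2.2
    have hκ'1 : ContDiff ℝ 1 (deriv κ) := hκ'.of_le (by norm_cast; omega)
    have hT : timeAvg (deriv κ) (timeDeriv v) = fun y => -timeAvg (deriv (deriv κ)) v y :=
      funext fun y => timeAvg_timeDeriv hκ'1 hs.deriv hv1 y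
    have h2 := h v hv _ hκ'' hs.deriv.deriv
    have hmean := hA.integral_timeAvg_deriv_timeDeriv hv hκ1 hs
    simp_rw [hT, integral_neg, neg_eq_zero] at hmean
    have hP := poincare_unitCell (contDiff_timeAvg hκ''.continuous hs.deriv.deriv hv1)
      (timeAvg_periodic _ hv.periodic) hmean
    simp_rw [partialDeriv_timeAvg hκ''.continuous hs.deriv.deriv hv1] at hP
    have h1 := hA.integral_sq_gradient_timeAvg_le hv hκ1 hs
    simp_rw [hT, neg_sq] at h1
    rw [iteratedDeriv_succ', iteratedDeriv_succ']
    calc _ ≤ _ := h1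
      _ ≤ d / m ^ 2 * (d * _) := mul_le_mul_of_nonneg_left
          (hP.trans (mul_le_mul_of_nonneg_left h2 (Nat.cast_nonneg d))) (by positivity)
      _ = _ := by ring

end Decay

section Oscillation

/-- Smooth averages of mean-zero periodic functions on the line are small. -/
lemma abs_integral_mul_periodic_le (n : ℕ) : ∀ {κ H : ℝ → ℝ} {B : ℝ}, ContDiff ℝ n κ →
    HasCompactSupport κ → Continuous H → Function.Periodic H 1 → (∫ t in (0 : ℝ)..1, H t) = 0 →
    (∀ t, |H t| ≤ B) → |∫ t, κ t * H t| ≤ 2 ^ n * B * ∫ t, |iteratedDeriv n κ t| := by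
  induction n with
  | zero =>
    intro κ H B hκ hs hH hper hmean hB
    have hκc := hκ.continuous
    simp only [iteratedDeriv_zero, pow_zero, one_mul]
    rw [← integral_const_mul]
    refine (abs_integral_le_integral_abs).trans (integral_mono ?_ ?_ fun t => ?_)
    · exact Continuous.integrable_of_hasCompactSupport (by fun_prop)
        (hs.mul_right (f' := H) |>.comp_left (g := abs) abs_zero)
    · exact (Continuous.integrable_of_hasCompactSupport hκc hs).abs.const_mul B
    · simp only [abs_mul]
      rw [mul_comm]
      gcongr
      exact hB t
  | succ n ih =>
    intro κ H B hκ hs hH hper hmean hB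
    set P : ℝ → ℝ := fun t => ∫ r in (0 : ℝ)..t, H r
    have hPd : ∀ t, HasDerivAt P (H t) t := fun t =>
      intervalIntegral.integral_hasDerivAt_right (hH.intervalIntegrable _ _)
        (hH.stronglyMeasurableAtFilter _ _) hH.continuousAt
    have hPc : Continuous P := continuous_iff_continuousAt.2 fun t => (hPd t).continuousAt
    have hPp : Function.Periodic P 1 := by
      intro t
      have h1 := hper.intervalIntegral_add_eq t 0
      rw [zero_add, hmean] at h1
      have h2 := intervalIntegral.integral_add_adjacent_intervals
        (hH.intervalIntegrable (μ := volume) 0 t) (hH.intervalIntegrable t (t + 1))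
      simp only [P]
      rw [← h2, h1, add_zero]
    have hPB : ∀ t, |P t| ≤ B := by
      intro t
      obtain ⟨r, hr, hrt⟩ := hPp.exists_mem_Ico₀ one_pos t
      rw [hrt]
      have h := intervalIntegral.norm_integral_le_of_norm_le_const (a := 0) (b := r) (f := H)
        (C := B) fun x _ => hB x
      rw [Real.norm_eq_abs, sub_zero, abs_of_nonneg hr.1] at h
      have hB0 : 0 ≤ B := (abs_nonneg _).trans (hB 0)
      exact h.trans (by nlinarith [hr.2])
    set c := ∫ t in (0 : ℝ)..1, P t
    have hc : |c| ≤ B := by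
      have h := intervalIntegral.norm_integral_le_of_norm_le_const (a := 0) (b := 1) (f := P)
        (C := B) fun x _ => hPB x
      simpa using h
    have hκ1 : ContDiff ℝ 1 κ := hκ.of_le (by norm_cast; omega)
    have hκ' : ContDiff ℝ (n : ℕ) (deriv κ) :=
      ((contDiff_succ_iff_deriv (n := (n : ℕ))).1 (by exact_mod_cast hκ)).2.2
    have hκc := hκ1.continuous
    have hκ'c := hκ'.continuous
    have hparts : ∫ t, κ t * H t = -∫ t, deriv κ t * (P t - c) :=
      integral_mul_deriv_eq_deriv_mul_of_integrable (v := fun t => P t - c)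
        (fun t _ => (hκ1.differentiable one_ne_zero t).hasDerivAt)
        (fun t _ => (hPd t).sub_const c)
        (Continuous.integrable_of_hasCompactSupport (hκc.mul hH) hs.mul_right)
        (Continuous.integrable_of_hasCompactSupport (hκ'c.mul (hPc.sub continuous_const))
          hs.deriv.mul_right)
        (Continuous.integrable_of_hasCompactSupport (hκc.mul (hPc.sub continuous_const))
          hs.mul_right)
    have h := ih (H := fun t => P t - c) (B := 2 * B) hκ' hs.deriv (hPc.sub continuous_const)
      (fun t => by simp only [hPp t])
      (by
        rw [intervalIntegral.integral_sub (hPc.intervalIntegrable _ _) (by simp)]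
        simp [c])
      fun t => (abs_sub _ _).trans (by linarith [hPB t])
    rw [hparts, abs_neg, iteratedDeriv_succ']
    exact h.trans_eq (by ring)

/-- Smooth averages of periodic functions on the line are close to their mean. -/
lemma abs_integral_mul_periodic_sub_le {n : ℕ} {κ H : ℝ → ℝ} {B : ℝ} (hκ : ContDiff ℝ n κ)
    (hs : HasCompactSupport κ) (hmass : ∫ t, κ t = 1) (hH : Continuous H)
    (hper : Function.Periodic H 1) (hB : ∀ t, |H t| ≤ B) :
    |(∫ t, κ t * H t) - ∫ t in (0 : ℝ)..1, H t|
      ≤ 2 ^ (n + 1) * (∫ t, |iteratedDeriv n κ t|) * B := by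
  set c := ∫ t in (0 : ℝ)..1, H t
  have hc : |c| ≤ B := by
    have h := intervalIntegral.norm_integral_le_of_norm_le_const (a := 0) (b := 1) (f := H)
      (C := B) fun x _ => hB x
    simpa using h
  have hκc := hκ.continuous
  have h := abs_integral_mul_periodic_le n (H := fun t => H t - c) (B := 2 * B) hκ hs
    (hH.sub continuous_const) (fun t => by simp only [hper t])
    (by
      rw [intervalIntegral.integral_sub (hH.intervalIntegrable _ _) (by simp)]
      simp [c])
    fun t => (abs_sub _ _).trans (by linarith [hB t])
  simp_rw [mul_sub] at h
  rw [integral_sub (f := fun t => κ t * H t)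
    (Continuous.integrable_of_hasCompactSupport (hκc.mul hH) hs.mul_right)
    ((Continuous.integrable_of_hasCompactSupport hκc hs).mul_const c), integral_mul_const, hmass,
    one_mul] at h
  exact h.trans_eq (by ring)

/-- Fubini's theorem for splitting off the first coordinate. -/
lemma integral_fin_succ {d : ℕ} {F : (Fin (d + 1) → ℝ) → ℝ} (hF : Integrable F) :
    ∫ y, F y = ∫ y : Fin d → ℝ, ∫ t : ℝ, F (Fin.cons t y) := by
  have hmp := (volume_preserving_piFinSuccAbove (fun _ : Fin (d + 1) => ℝ) 0).symm
  rw [← hmp.integral_comp' F]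
  have hi := hmp.integrable_comp_emb (MeasurableEquiv.measurableEmbedding _) |>.2 hF
  rw [Measure.volume_eq_prod] at hi ⊢
  refine (integral_prod_symm _ hi).trans ?_
  congr 1 with y
  congr 1 with t
  simp [MeasurableEquiv.piFinSuccAbove, Fin.insertNthEquiv]

variable {d : ℕ}

lemma hasCompactSupport_prod {κ : ℝ → ℝ} (hs : HasCompactSupport κ) (d : ℕ) :
    HasCompactSupport fun y : Fin d → ℝ => ∏ j, κ (y j) := by
  refine HasCompactSupport.intro (isCompact_univ_pi fun _ : Fin d => hs) fun y hy => ?_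
  simp only [Set.mem_pi, Set.mem_univ, true_imp_iff, not_forall] at hy
  obtain ⟨j, hj⟩ := hy
  exact Finset.prod_eq_zero (Finset.mem_univ j) (image_eq_zero_of_notMem_tsupport hj)

lemma integrable_prod_mul {κ : ℝ → ℝ} (hκ : Continuous κ) (hs : HasCompactSupport κ)
    {g : (Fin d → ℝ) → ℝ} (hg : Continuous g) : Integrable fun y => (∏ j, κ (y j)) * g y :=
  Continuous.integrable_of_hasCompactSupport (by fun_prop) (hasCompactSupport_prod hs d).mul_right

lemma setIntegral_unitCell_succ {g : (Fin (d + 1) → ℝ) → ℝ} (hg : Continuous g) :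
    ∫ y in unitCell (d + 1), g y
      = ∫ y in unitCell d, ∫ t in (0 : ℝ)..1, g (Fin.cons t y) := by
  rw [← integral_indicator measurableSet_unitCell, integral_fin_succ
    (hg.integrableOn_unitCell.integrable_indicator measurableSet_unitCell),
    ← integral_indicator measurableSet_unitCell]
  congr 1 with y
  by_cases hy : y ∈ unitCell d
  · rw [Set.indicator_of_mem hy, intervalIntegral.integral_of_le zero_le_one,
      ← integral_Icc_eq_integral_Ioc, ← integral_indicator measurableSet_Icc]
    congr 1 with t
    by_cases ht : t ∈ Set.Icc (0 : ℝ) 1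
    · rw [Set.indicator_of_mem ht, Set.indicator_of_mem]
      intro i _
      refine Fin.cases ?_ (fun j => ?_) i
      · simpa using ht
      · simpa using hy j trivial
    · rw [Set.indicator_of_notMem ht, Set.indicator_of_notMem]
      exact fun h => ht (by simpa using h 0 trivial)
  · rw [Set.indicator_of_notMem hy]
    refine integral_eq_zero_of_ae (Filter.Eventually.of_forall fun t => ?_)
    exact Set.indicator_of_notMem (fun h => hy fun j _ => by simpa using h j.succ trivial) g

/-- Smooth product averages of periodic functions are close to their mean. -/
lemma abs_integral_prod_mul_sub_le {n : ℕ} {κ : ℝ → ℝ} (hκ : ContDiff ℝ n κ)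
    (hs : HasCompactSupport κ) (hmass : ∫ t, κ t = 1) :
    ∀ (d : ℕ) {g : (Fin d → ℝ) → ℝ} {B : ℝ}, Continuous g → LatticePeriodic g →
      (∀ y, |g y| ≤ B) →
      |(∫ y, (∏ j, κ (y j)) * g y) - ∫ y in unitCell d, g y|
        ≤ (∑ j ∈ Finset.range d, (∫ t, |κ t|) ^ j)
          * (2 ^ (n + 1) * (∫ t, |iteratedDeriv n κ t|) * B) := by
  have hκc := hκ.continuous
  intro d
  induction d with
  | zero =>
    intro g B hg hp hB
    have : (unitCell 0) = Set.univ := by ext y; simp [unitCell]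
    simp [this]
  | succ d ih =>
    intro g B hg hp hB
    set G : (Fin d → ℝ) → ℝ := fun y => ∫ t in (0 : ℝ)..1, g (Fin.cons t y)
    have hcons : Continuous fun p : (Fin d → ℝ) × ℝ => (Fin.cons p.2 p.1 : Fin (d + 1) → ℝ) :=
      Continuous.finCons continuous_snd continuous_fst
    have hgc : Continuous fun p : (Fin d → ℝ) × ℝ => g (Fin.cons p.2 p.1) := hg.comp hcons
    have hslice : ∀ y : Fin d → ℝ, Continuous fun t : ℝ => g (Fin.cons t y) := fun y =>
      hgc.comp (Continuous.prodMk_right y)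
    have hG : Continuous G := intervalIntegral.continuous_parametric_intervalIntegral_of_continuous'
      (f := fun y t => g (Fin.cons t y)) hgc 0 1
    have hGp : LatticePeriodic G := by
      intro y k
      simp only [G]
      congr 1 with t
      rw [← hp (Fin.cons t y) (Fin.cons 0 k)]
      congr 1
      ext i
      refine Fin.cases ?_ (fun j => ?_) i <;> simp
    have hGB : ∀ y, |G y| ≤ B := fun y => by
      have h := intervalIntegral.norm_integral_le_of_norm_le_const (a := 0) (b := 1)
        (f := fun t => g (Fin.cons t y)) (C := B) fun x _ => hB _
      simpa using h
    set W : (Fin d → ℝ) → ℝ := timeAvg κ fun p => g (Fin.cons p.2 p.1)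
    have hW : Continuous W := continuous_timeAvg hκc hs hgc
    have hWG : ∀ y, |W y - G y| ≤ 2 ^ (n + 1) * (∫ t, |iteratedDeriv n κ t|) * B := fun y => by
      refine abs_integral_mul_periodic_sub_le hκ hs hmass (hslice y) (fun t => ?_) fun t => hB _
      change g (Fin.cons (t + 1) y) = g (Fin.cons t y)
      rw [← hp (Fin.cons t y) (Fin.cons 1 0)]
      congr 1
      ext i
      refine Fin.cases ?_ (fun j => ?_) i <;> simp
    have h1 : ∫ y, (∏ j, κ (y j)) * g y = ∫ y : Fin d → ℝ, (∏ j, κ (y j)) * W y := by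
      rw [integral_fin_succ (integrable_prod_mul hκc hs hg)]
      congr 1 with y
      simp only [W, timeAvg]
      rw [← integral_const_mul]
      congr 1 with t
      simp only [Fin.prod_univ_succ, Fin.cons_zero, Fin.cons_succ]
      ring
    have h2 : |(∫ y : Fin d → ℝ, (∏ j, κ (y j)) * W y) - ∫ y : Fin d → ℝ, (∏ j, κ (y j)) * G y|
        ≤ (∫ t, |κ t|) ^ d * (2 ^ (n + 1) * (∫ t, |iteratedDeriv n κ t|) * B) := by
      rw [← integral_sub (integrable_prod_mul hκc hs hW) (integrable_prod_mul hκc hs hG)]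
      have hpow : (∫ t, |κ t|) ^ d = ∫ y : Fin d → ℝ, ∏ j, |κ (y j)| := by
        rw [integral_fintype_prod_volume_eq_pow (fun t => |κ t|), Fintype.card_fin]
      rw [hpow, ← integral_mul_const]
      have hab : HasCompactSupport fun t => |κ t| := hs.comp_left (g := abs) abs_zero
      refine (abs_integral_le_integral_abs).trans (integral_mono ?_ ?_ fun y => ?_)
      · exact ((integrable_prod_mul hκc hs hW).sub (integrable_prod_mul hκc hs hG)).abs
      · exact integrable_prod_mul hκc.abs hab continuous_const
      · simp only
        rw [← mul_sub, abs_mul, Finset.abs_prod]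
        exact mul_le_mul_of_nonneg_left (hWG y) (Finset.prod_nonneg fun j _ => abs_nonneg _)
    rw [h1, setIntegral_unitCell_succ hg, Finset.sum_range_succ, add_mul]
    have h3 := ih hG hGp hGB
    have h4 := abs_add_le ((∫ y : Fin d → ℝ, (∏ j, κ (y j)) * W y)
      - ∫ y : Fin d → ℝ, (∏ j, κ (y j)) * G y)
      ((∫ y : Fin d → ℝ, (∏ j, κ (y j)) * G y) - ∫ y in unitCell d, G y)
    rw [sub_add_sub_cancel] at h4
    linarith

end Oscillation

section Kernel

/-- The rescaled kernel `K_N(t) = N⁻¹ K(t / N)`. -/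
noncomputable def scaledKernel (K : ℝ → ℝ) (N t : ℝ) : ℝ := N⁻¹ * K (t / N)

variable {K : ℝ → ℝ} {N : ℝ}

lemma contDiff_scaledKernel {n : ℕ} (hK : ContDiff ℝ n K) : ContDiff ℝ n (scaledKernel K N) :=
  contDiff_const.mul (hK.comp (contDiff_id.div_const N))

lemma scaledKernel_eq_zero (hK : Function.support K ⊆ Set.Icc (-1 : ℝ) 1) (hN : 0 < N) {t : ℝ}
    (ht : N < |t|) : scaledKernel K N t = 0 := by
  have : K (t / N) = 0 := by
    by_contra h
    have h1 := abs_le.2 (hK h)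
    rw [abs_div, abs_of_pos hN, div_le_one hN] at h1
    linarith
  simp [scaledKernel, this]

lemma hasCompactSupport_scaledKernel (hK : Function.support K ⊆ Set.Icc (-1 : ℝ) 1)
    (hN : 0 < N) : HasCompactSupport (scaledKernel K N) := by
  refine HasCompactSupport.intro (isCompact_Icc (a := -N) (b := N)) fun t ht => ?_
  refine scaledKernel_eq_zero hK hN ?_
  by_contra h
  exact ht (abs_le.1 (not_lt.1 h))

lemma integral_scaledKernel (hN : 0 < N) : ∫ t, scaledKernel K N t = ∫ t, K t := by
  unfold scaledKernel
  rw [integral_const_mul, Measure.integral_comp_div K N, abs_of_pos hN, smul_eq_mul,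
    inv_mul_cancel_left₀ hN.ne']

lemma integral_abs_iteratedDeriv_scaledKernel {n : ℕ} (hK : ContDiff ℝ n K) (hN : 0 < N) :
    ∫ t, |iteratedDeriv n (scaledKernel K N) t| = N⁻¹ ^ n * ∫ t, |iteratedDeriv n K t| := by
  have h : ∀ t, |iteratedDeriv n (scaledKernel K N) t|
      = N⁻¹ ^ n * scaledKernel (fun t => |iteratedDeriv n K t|) N t := by
    intro t
    have h1 := congrFun (iteratedDeriv_comp_const_mul hK N⁻¹) t
    have h2 : scaledKernel K N = fun t => N⁻¹ * (fun x => K (N⁻¹ * x)) t := by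
      ext t
      simp [scaledKernel, div_eq_inv_mul]
    rw [h2, iteratedDeriv_const_mul_field, h1, abs_mul, abs_mul, abs_pow,
      abs_of_pos (inv_pos.2 hN), scaledKernel, div_eq_inv_mul]
    ring
  simp_rw [h]
  rw [integral_const_mul, integral_scaledKernel hN]

lemma integral_abs_scaledKernel (hN : 0 < N) : ∫ t, |scaledKernel K N t| = ∫ t, |K t| := by
  rw [← integral_scaledKernel (K := fun t => |K t|) hN]
  simp [scaledKernel, abs_mul, abs_of_pos hN]

end Kernel

section Weight

/-- A one-dimensional periodic weight localized near the integers at scale `N`. -/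
noncomputable def localizer (N t : ℝ) : ℝ := (1 + (Real.sin (Real.pi * t) / N) ^ 2)⁻¹

lemma localizer_pos (N t : ℝ) : 0 < localizer N t := by
  unfold localizer
  positivity

lemma localizer_periodic (N : ℝ) : Function.Periodic (localizer N) 1 := by
  intro t
  simp [localizer, mul_add, Real.sin_add_pi, neg_div]

lemma contDiff_localizer (N : ℝ) : ContDiff ℝ 1 (localizer N) := by
  refine ContDiff.inv ?_ fun t => by positivity
  exact contDiff_const.add (((Real.contDiff_sin.comp
    (contDiff_const.mul contDiff_id)).div_const N).pow 2)

lemma abs_deriv_localizer_le {N : ℝ} (hN : 0 < N) (t : ℝ) :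
    |deriv (localizer N) t| ≤ Real.pi / N * localizer N t := by
  set σ := Real.sin (Real.pi * t) / N with hσ
  have h0 : (1 + σ ^ 2) ≠ 0 := by positivity
  have h1 : HasDerivAt (fun t => Real.sin (Real.pi * t) / N)
      (Real.cos (Real.pi * t) * Real.pi / N) t := by
    simpa using (((hasDerivAt_id t).const_mul Real.pi).sin).div_const N
  have h2 := ((h1.fun_pow 2).const_add 1).fun_inv h0
  have h3 : deriv (localizer N) t = _ := h2.deriv
  rw [h3, localizer, ← hσ]
  have hpi := Real.pi_pos
  have hc := Real.abs_cos_le_one (Real.pi * t)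
  rw [abs_div, abs_neg, abs_of_pos (by positivity : 0 < (1 + σ ^ 2) ^ 2), div_le_iff₀ (by positivity)]
  have h4 : Real.pi / N * (1 + σ ^ 2)⁻¹ * (1 + σ ^ 2) ^ 2 = Real.pi / N * (1 + σ ^ 2) := by
    field_simp
  rw [h4]
  have h5 : |2 * σ| ≤ 1 + σ ^ 2 := by
    rw [abs_le]
    constructor <;> nlinarith [sq_nonneg (σ + 1), sq_nonneg (σ - 1)]
  have h6 : ((2 : ℕ) : ℝ) * σ ^ (2 - 1) * (Real.cos (Real.pi * t) * Real.pi / N)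
      = (Real.pi / N) * ((2 * σ) * Real.cos (Real.pi * t)) := by
    simp; ring
  rw [h6, abs_mul, abs_of_pos (by positivity : 0 < Real.pi / N)]
  gcongr
  rw [abs_mul]
  nlinarith [abs_nonneg (2 * σ), abs_nonneg (Real.cos (Real.pi * t))]

lemma le_localizer {N t : ℝ} (hN : 0 < N) (ht : |t| ≤ N) :
    (1 + Real.pi ^ 2)⁻¹ ≤ localizer N t := by
  unfold localizer
  have h1 : (Real.sin (Real.pi * t) / N) ^ 2 ≤ Real.pi ^ 2 := by
    rw [div_pow, div_le_iff₀ (by positivity)]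
    have h2 := Real.sin_sq_le_sq (x := Real.pi * t)
    have h3 : t ^ 2 ≤ N ^ 2 := by rw [← sq_abs]; gcongr
    calc _ ≤ (Real.pi * t) ^ 2 := h2
      _ = Real.pi ^ 2 * t ^ 2 := by ring
      _ ≤ _ := by gcongr
  gcongr

lemma integral_localizer_le {N : ℝ} (hN : 0 < N) :
    ∫ t in (0 : ℝ)..1, localizer N t ≤ Real.pi / 2 * N := by
  have h1 := (localizer_periodic N).intervalIntegral_add_eq 0 (-(1 / 2))
  rw [zero_add] at h1
  have hc := (contDiff_localizer N).continuous
  have hmaj : ∀ t ∈ Set.Icc (-(1 / 2) : ℝ) (-(1 / 2) + 1),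
      localizer N t ≤ (1 + (2 / N * t) ^ 2)⁻¹ := by
    intro t ht
    unfold localizer
    have hpi := Real.pi_pos
    have ht' : |t| ≤ 1 / 2 := abs_le.2 ⟨ht.1, by linarith [ht.2]⟩
    have h2 := Real.mul_abs_le_abs_sin (x := Real.pi * t) (by
      rw [abs_mul, abs_of_pos hpi]; nlinarith)
    rw [abs_mul, abs_of_pos hpi] at h2
    have h3 : 2 / Real.pi * (Real.pi * |t|) = |2 * t| := by
      rw [abs_mul, abs_two]; field_simp
    rw [h3] at h2
    have h4 := sq_le_sq.2 h2
    have h5 : (2 / N * t) ^ 2 ≤ (Real.sin (Real.pi * t) / N) ^ 2 := by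
      rw [div_pow, div_mul_eq_mul_div, div_pow]
      gcongr
    gcongr
  have hint : Integrable fun t : ℝ => (1 + (2 / N * t) ^ 2)⁻¹ :=
    integrable_inv_one_add_sq.comp_mul_left' (by positivity)
  have hmc : Continuous fun t : ℝ => (1 + (2 / N * t) ^ 2)⁻¹ :=
    Continuous.inv₀ (by fun_prop) fun t => by positivity
  rw [h1]
  calc _ ≤ ∫ t in (-(1 / 2) : ℝ)..(-(1 / 2) + 1), (1 + (2 / N * t) ^ 2)⁻¹ :=
        intervalIntegral.integral_mono_on (by norm_num) (hc.intervalIntegrable _ _)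
          (hmc.intervalIntegrable _ _) hmaj
    _ ≤ ∫ t : ℝ, (1 + (2 / N * t) ^ 2)⁻¹ := by
        rw [intervalIntegral.integral_of_le (by norm_num)]
        exact setIntegral_le_integral hint (Filter.Eventually.of_forall fun t => by positivity)
    _ = Real.pi / 2 * N := by
        rw [Measure.integral_comp_mul_left (fun t : ℝ => (1 + t ^ 2)⁻¹),
          integral_univ_inv_one_add_sq, abs_of_pos (by positivity), smul_eq_mul]
        field_simp

lemma partialDeriv_prod {d : ℕ} {r : ℝ → ℝ} (hr : Differentiable ℝ r) (i : Fin d)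
    (y : Fin d → ℝ) : partialDeriv i (fun y => ∏ j, r (y j)) y
      = (∏ j ∈ Finset.univ.erase i, r (y j)) * deriv r (y i) := by
  have h : ∀ j ∈ Finset.univ, HasFDerivAt (fun y : Fin d → ℝ => r (y j))
      (deriv r (y j) • ContinuousLinearMap.proj (R := ℝ) (φ := fun _ : Fin d => ℝ) j) y :=
    fun j _ => (hr (y j)).hasDerivAt.comp_hasFDerivAt y (hasFDerivAt_apply j y)
  rw [partialDeriv, (HasFDerivAt.finsetProd h).fderiv]
  simp [Pi.single_apply]

/-- Slowly varying periodic weights localized at scale `N` around the lattice. -/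
lemma exists_slowWeight (d : ℕ) {N : ℝ} (hN : 0 < N) :
    ∃ ρ : (Fin d → ℝ) → ℝ, IsSlowWeight ρ (Real.pi / N) ∧
      (∀ y, (∀ j, |y j| ≤ N) → (1 + Real.pi ^ 2)⁻¹ ^ d ≤ ρ y) ∧
      ∫ y in unitCell d, ρ y ≤ (Real.pi / 2 * N) ^ d := by
  refine ⟨fun y => ∏ j, localizer N (y j), ⟨?_, ?_, ?_, ?_, ?_⟩, ?_, ?_⟩
  · exact contDiff_prod fun j _ => (contDiff_localizer N).comp (contDiff_apply ℝ ℝ j)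
  · intro y k
    refine Finset.prod_congr rfl fun j _ => ?_
    simpa using (localizer_periodic N).int_mul (k j) (y j)
  · exact fun y => Finset.prod_nonneg fun j _ => (localizer_pos N _).le
  · have := Real.pi_pos
    positivity
  · intro i y
    rw [partialDeriv_prod ((contDiff_localizer N).differentiable one_ne_zero), abs_mul,
      abs_of_nonneg (Finset.prod_nonneg fun j _ => (localizer_pos N _).le),
      ← Finset.prod_erase_mul _ _ (Finset.mem_univ i), mul_left_comm]
    exact mul_le_mul_of_nonneg_left (abs_deriv_localizer_le hN _)
      (Finset.prod_nonneg fun j _ => (localizer_pos N _).le)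
  · intro y hy
    calc (1 + Real.pi ^ 2)⁻¹ ^ d = ∏ _j : Fin d, (1 + Real.pi ^ 2)⁻¹ := by simp
      _ ≤ _ := Finset.prod_le_prod (fun j _ => by positivity) fun j _ => le_localizer hN (hy j)
  · have h : ∫ y in unitCell d, ∏ j, localizer N (y j)
        = (∫ t in (0 : ℝ)..1, localizer N t) ^ d := by
      rw [unitCell, volume_pi, Measure.restrict_pi_pi, integral_fintype_prod_eq_pow,
        Fintype.card_fin, intervalIntegral.integral_of_le zero_le_one,
        integral_Icc_eq_integral_Ioc]
    rw [h]
    refine pow_le_pow_left₀ ?_ (integral_localizer_le hN) d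
    exact intervalIntegral.integral_nonneg zero_le_one fun t _ => (localizer_pos N t).le

end Weight

section WavePart

variable {d : ℕ}

/-- Cauchy–Schwarz with respect to a weight. -/
lemma sq_integral_weight_mul_abs_le {ρ f : (Fin d → ℝ) → ℝ} (hρ : Continuous ρ)
    (hρ0 : ∀ y, 0 ≤ ρ y) (hf : Continuous f) :
    (∫ y in unitCell d, ρ y * |f y|) ^ 2
      ≤ (∫ y in unitCell d, ρ y) * ∫ y in unitCell d, ρ y * f y ^ 2 := by
  have h := sq_integral_mul_le (μ := volume.restrict (unitCell d)) (a := fun y => √(ρ y))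
    (b := fun y => √(ρ y) * |f y|)
    (Continuous.integrableOn_unitCell (by fun_prop))
    (Continuous.integrableOn_unitCell (by fun_prop))
    (Continuous.integrableOn_unitCell (by fun_prop))
  simpa only [← mul_assoc, fun y => Real.mul_self_sqrt (hρ0 y), mul_pow,
    fun y => Real.sq_sqrt (hρ0 y), sq_abs] using h

/-- Product averages of periodic functions are controlled by weighted integrals over the cell. -/
lemma abs_integral_prod_scaledKernel_le {K : ℝ → ℝ} {N M r₀ : ℝ} {n : ℕ} (hKc : Continuous K)
    (hK : Function.support K ⊆ Set.Icc (-1 : ℝ) 1) (hM : ∀ t, |K t| ≤ M) (hN : 0 < N)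
    (hn : N ≤ n) {ρ g : (Fin d → ℝ) → ℝ} (hρ : Continuous ρ) (hρp : LatticePeriodic ρ)
    (hρ0 : ∀ y, 0 ≤ ρ y) (hr₀ : 0 < r₀) (hρr : ∀ y, (∀ j, |y j| ≤ N) → r₀ ≤ ρ y)
    (hg : Continuous g) (hgp : LatticePeriodic g) :
    |∫ y, (∏ j, scaledKernel K N (y j)) * g y|
      ≤ r₀⁻¹ * (2 * n * M / N) ^ d * ∫ y in unitCell d, ρ y * |g y| := by
  have hM0 : 0 ≤ M := (abs_nonneg _).trans (hM 0)
  have hκc : Continuous (scaledKernel K N) := by unfold scaledKernel; fun_prop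
  have hs := hasCompactSupport_scaledKernel hK hN
  set I : Set (Fin d → ℝ) := Set.Icc (fun _ => -(n : ℝ)) (fun _ => (n : ℝ))
  have hpt : ∀ y, |(∏ j, scaledKernel K N (y j)) * g y|
      ≤ I.indicator (fun y => r₀⁻¹ * (M / N) ^ d * (ρ y * |g y|)) y := by
    intro y
    by_cases hy : ∀ j, |y j| ≤ N
    · have hyI : y ∈ I := ⟨fun j => by linarith [(abs_le.1 (hy j)).1],
        fun j => by linarith [(abs_le.1 (hy j)).2]⟩
      rw [Set.indicator_of_mem hyI, abs_mul, Finset.abs_prod]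
      have h1 : ∏ j, |scaledKernel K N (y j)| ≤ (M / N) ^ d := by
        calc _ ≤ ∏ _j : Fin d, M / N := by
              refine Finset.prod_le_prod (fun j _ => abs_nonneg _) fun j _ => ?_
              rw [scaledKernel, abs_mul, abs_of_pos (inv_pos.2 hN), div_eq_inv_mul M N]
              exact mul_le_mul_of_nonneg_left (hM _) (inv_nonneg.2 hN.le)
          _ = _ := by rw [Finset.prod_const, Finset.card_univ, Fintype.card_fin]
      have h2 : 1 ≤ r₀⁻¹ * ρ y := by
        rw [← div_eq_inv_mul, le_div_iff₀ hr₀, one_mul]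
        exact hρr y hy
      calc _ ≤ (M / N) ^ d * |g y| := by gcongr
        _ ≤ (M / N) ^ d * |g y| * (r₀⁻¹ * ρ y) := le_mul_of_one_le_right (by positivity) h2
        _ = _ := by ring
    · push Not at hy
      obtain ⟨j, hj⟩ := hy
      rw [Finset.prod_eq_zero (Finset.mem_univ j) (scaledKernel_eq_zero hK hN hj), zero_mul,
        abs_zero]
      exact Set.indicator_nonneg (fun y _ => mul_nonneg (by positivity)
        (mul_nonneg (hρ0 y) (abs_nonneg _))) y
  have hcont : Continuous fun y => ρ y * |g y| := by fun_prop
  have hI : MeasurableSet I := measurableSet_Icc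
  have hint : IntegrableOn (fun y => r₀⁻¹ * (M / N) ^ d * (ρ y * |g y|)) I :=
    (continuous_const.mul hcont).continuousOn.integrableOn_compact isCompact_Icc
  calc _ ≤ ∫ y, I.indicator (fun y => r₀⁻¹ * (M / N) ^ d * (ρ y * |g y|)) y :=
        (abs_integral_le_integral_abs).trans (integral_mono
          (integrable_prod_mul hκc hs hg).abs (hint.integrable_indicator hI) hpt)
    _ = r₀⁻¹ * (M / N) ^ d * ∫ y in I, ρ y * |g y| := by
        rw [integral_indicator hI, integral_const_mul]
    _ ≤ r₀⁻¹ * (M / N) ^ d * ((2 * n) ^ d * ∫ y in unitCell d, ρ y * |g y|) := by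
        gcongr
        exact setIntegral_Icc_le_of_latticePeriodic hcont
          (fun y k => by simp only [hρp y k, hgp y k])
          (fun y => mul_nonneg (hρ0 y) (abs_nonneg _)) n
    _ = _ := by
        rw [div_pow, div_pow, mul_pow _ M]
        ring

lemma integral_kernel_swap {κ : ℝ → ℝ} (hκ : Continuous κ) (hs : HasCompactSupport κ)
    {f : (Fin d → ℝ) × ℝ → ℝ} (hf : Continuous f) :
    ∫ s, κ s * ∫ y : Fin d → ℝ, (∏ j, κ (y j)) * f (y, s)
      = ∫ y : Fin d → ℝ, (∏ j, κ (y j)) * timeAvg κ f y := by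
  unfold timeAvg
  simp_rw [← integral_const_mul]
  rw [integral_integral_swap (f := fun s y => κ s * ((∏ j, κ (y j)) * f (y, s)))]
  · congr 1 with y
    congr 1 with s
    ring
  · refine Continuous.integrable_of_hasCompactSupport (f := fun z : ℝ × (Fin d → ℝ) =>
      κ z.1 * ((∏ j, κ (z.2 j)) * f (z.2, z.1))) (by fun_prop) ?_
    refine HasCompactSupport.intro
      (hs.prod (isCompact_univ_pi fun _ : Fin d => hs)) fun z hz => ?_
    by_cases h1 : z.1 ∈ tsupport κ
    · have h2 : z.2 ∉ Set.univ.pi fun _ : Fin d => tsupport κ := fun h => hz ⟨h1, h⟩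
      simp only [Set.mem_pi, Set.mem_univ, true_imp_iff, not_forall] at h2
      obtain ⟨j, hj⟩ := h2
      rw [Finset.prod_eq_zero (Finset.mem_univ j) (image_eq_zero_of_notMem_tsupport (f := κ) hj)]
      simp
    · rw [image_eq_zero_of_notMem_tsupport h1, zero_mul]

variable {A : (Fin d → ℝ) → Matrix (Fin d) (Fin d) ℝ} {m Λ : ℝ} {K : ℝ → ℝ} {q : ℕ}

/-- Averaged flux of a wave for kernels wider than the period. -/
lemma IsEllipticCoeff.exists_flux_bound_of_one_le (hA : IsEllipticCoeff A m Λ)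
    (hKs : ContDiff ℝ q K) (hK : Function.support K ⊆ Set.Icc (-1 : ℝ) 1) :
    ∃ C, 0 ≤ C ∧ ∀ N, 1 ≤ N → ∀ v, IsPeriodicWave A v → ∀ D, 0 ≤ D →
      (∀ y, energyDensity A v (y, 0) ≤ D ^ 2) → ∀ i,
      |∫ s, scaledKernel K N s * ∫ y : Fin d → ℝ, (∏ j, scaledKernel K N (y j)) * flux A i v (y, s)|
        ≤ C * D * N⁻¹ ^ q := by
  have hKc := hKs.continuous
  have hKsupp : HasCompactSupport K := HasCompactSupport.of_support_subset_isCompact isCompact_Icc hK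
  obtain ⟨M, hM⟩ := hKc.bounded_above_of_compact_support hKsupp
  have hM0 : 0 ≤ M := (norm_nonneg _).trans (hM 0)
  obtain ⟨C, hC, hdecay⟩ := hA.exists_gradient_decay q
  set J := ∫ t, |iteratedDeriv q K t|
  have hJ : 0 ≤ J := integral_nonneg fun t => abs_nonneg _
  refine ⟨(4 * M) ^ d * (√(Λ * C) * J), by positivity, fun N hN v hv D hD hE i => ?_⟩
  have hN0 : 0 < N := by linarith
  set κ := scaledKernel K N
  have hκ : ContDiff ℝ q κ := contDiff_scaledKernel hKs
  have hκc := hκ.continuous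
  have hs : HasCompactSupport κ := hasCompactSupport_scaledKernel hK hN0
  have hv1 : ContDiff ℝ 1 v := hv.contDiff.of_le (by norm_num)
  have hfl := (hA.contDiff_flux hv.contDiff i).continuous
  have hEc : Continuous fun y => energyDensity A v (y, 0) :=
    (hA.contDiff_energyDensity hv.contDiff).continuous.comp (by fun_prop)
  rw [integral_kernel_swap hκc hs hfl]
  have hgc : Continuous (timeAvg κ (flux A i v)) := continuous_timeAvg hκc hs hfl
  have hDc : ∀ j, Continuous (timeAvg κ (spaceDeriv j v)) := fun j =>
    continuous_timeAvg hκc hs (continuous_spaceDeriv hv1 j)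
  have h1 := abs_integral_prod_scaledKernel_le (ρ := fun _ => 1) hKc hK hM hN0
    (Nat.le_ceil N) continuous_const (fun _ _ => rfl) (fun _ => zero_le_one) one_pos
    (fun _ _ => le_rfl) hgc (timeAvg_periodic κ (hA.flux_periodic hv i))
  have h2 := sq_integral_weight_mul_abs_le (ρ := fun _ => 1) continuous_const
    (fun _ => zero_le_one) hgc
  simp only [inv_one, one_mul] at h1 h2
  have hone : ∫ _y in unitCell d, (1 : ℝ) = 1 := by simp [volume_real_unitCell]
  rw [hone, one_mul] at h2
  have h3 : ∫ y in unitCell d, timeAvg κ (flux A i v) y ^ 2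
      ≤ Λ * ∫ y in unitCell d, ∑ j, timeAvg κ (spaceDeriv j v) y ^ 2 := by
    rw [← integral_const_mul]
    refine setIntegral_mono (hgc.pow 2).integrableOn_unitCell (Continuous.integrableOn_unitCell ?_)
      fun y => ?_
    · exact continuous_const.mul (continuous_finsetSum _ fun j _ => (hDc j).pow 2)
    · simp only [timeAvg_flux hκc hs hv1]
      refine le_trans ?_ (hA.bound y fun j => timeAvg κ (spaceDeriv j v) y)
      exact Finset.single_le_sum
        (f := fun i => (∑ j, A y i j * timeAvg κ (spaceDeriv j v) y) ^ 2)
        (fun i _ => sq_nonneg _) (Finset.mem_univ i)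
  have h4 := hdecay v hv κ hκ hs
  have hE0 : ∫ y in unitCell d, energyDensity A v (y, 0) ≤ D ^ 2 := by
    calc _ ≤ ∫ _y in unitCell d, D ^ 2 := setIntegral_mono hEc.integrableOn_unitCell
          (continuous_const (y := D ^ 2)).integrableOn_unitCell hE
      _ = D ^ 2 := by simp [volume_real_unitCell]
  rw [integral_abs_iteratedDeriv_scaledKernel hKs hN0] at h4
  have hΛ := hA.bound_nonneg
  have h5 : (∫ y in unitCell d, |timeAvg κ (flux A i v) y|) ^ 2
      ≤ (√(Λ * C) * J * D * N⁻¹ ^ q) ^ 2 := by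
    calc _ ≤ _ := h2
      _ ≤ _ := h3
      _ ≤ Λ * (C * (N⁻¹ ^ q * J) ^ 2 * D ^ 2) := by
          gcongr
          refine h4.trans ?_
          gcongr
      _ = _ := by
          rw [mul_pow (√(Λ * C) * J * D), mul_pow (√(Λ * C) * J), mul_pow √(Λ * C),
            Real.sq_sqrt (by positivity)]
          ring
  have h6 : ∫ y in unitCell d, |timeAvg κ (flux A i v) y| ≤ √(Λ * C) * J * D * N⁻¹ ^ q :=
    le_of_sq_le_sq h5 (by positivity)
  have h7 : 2 * (⌈N⌉₊ : ℝ) * M / N ≤ 4 * M := by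
    rw [div_le_iff₀ hN0]
    have := (Nat.ceil_lt_add_one hN0.le).le
    nlinarith
  calc _ ≤ _ := h1
    _ ≤ (4 * M) ^ d * (√(Λ * C) * J * D * N⁻¹ ^ q) := by gcongr
    _ = _ := by ring

/-- Averaged flux of a wave for kernels narrower than the period. -/
lemma IsEllipticCoeff.exists_flux_bound_of_le_one (hA : IsEllipticCoeff A m Λ)
    (hKc : Continuous K) (hK : Function.support K ⊆ Set.Icc (-1 : ℝ) 1) :
    ∃ C, 0 ≤ C ∧ ∀ N, 0 < N → N ≤ 1 → ∀ v, IsPeriodicWave A v → ∀ D, 0 ≤ D →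
      (∀ y, energyDensity A v (y, 0) ≤ D ^ 2) → ∀ i,
      |∫ s, scaledKernel K N s * ∫ y : Fin d → ℝ, (∏ j, scaledKernel K N (y j)) * flux A i v (y, s)|
        ≤ C * D := by
  have hKsupp : HasCompactSupport K := HasCompactSupport.of_support_subset_isCompact isCompact_Icc hK
  obtain ⟨M, hM⟩ := hKc.bounded_above_of_compact_support hKsupp
  have hM0 : 0 ≤ M := (norm_nonneg _).trans (hM 0)
  set J := ∫ t, |K t|
  have hJ : 0 ≤ J := integral_nonneg fun t => abs_nonneg _
  have hm := hA.pos
  have hΛ := hA.bound_nonneg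
  have hpi := Real.pi_pos
  set c := √(Λ / m * Real.exp ((d + Λ / m) * Real.pi))
  set r₀ := (1 + Real.pi ^ 2)⁻¹ ^ d
  have hr₀ : 0 < r₀ := by positivity
  refine ⟨J * (r₀⁻¹ * (M * Real.pi) ^ d * c), by positivity, fun N hN hN1 v hv D hD hE i => ?_⟩
  set κ := scaledKernel K N
  have hκc : Continuous κ := by simp only [κ]; unfold scaledKernel; fun_prop
  have hs : HasCompactSupport κ := hasCompactSupport_scaledKernel hK hN
  have hfl := (hA.contDiff_flux hv.contDiff i).continuous
  have hEc := (hA.contDiff_energyDensity hv.contDiff).continuous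
  have hsl : ∀ {g : (Fin d → ℝ) × ℝ → ℝ}, Continuous g → ∀ s, Continuous fun y => g (y, s) :=
    fun hg s => hg.comp (by fun_prop)
  obtain ⟨ρ, hρ, hρr, hρI⟩ := exists_slowWeight d hN
  have hρc := hρ.contDiff.continuous
  have hρ0 : 0 ≤ ∫ y in unitCell d, ρ y := integral_nonneg hρ.nonneg
  have hslice : ∀ s, |s| ≤ N → |∫ y : Fin d → ℝ, (∏ j, κ (y j)) * flux A i v (y, s)|
      ≤ r₀⁻¹ * (M * Real.pi) ^ d * c * D := by
    intro s hs'
    have h1 := abs_integral_prod_scaledKernel_le (n := 1) hKc hK hM hN (by simpa using hN1) hρc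
      hρ.periodic hρ.nonneg hr₀ hρr (hsl hfl s) (hA.flux_periodic hv i s)
    have h2 := sq_integral_weight_mul_abs_le hρc hρ.nonneg (hsl hfl s)
    have h3 : ∫ y in unitCell d, ρ y * flux A i v (y, s) ^ 2
        ≤ Λ / m * ∫ y in unitCell d, ρ y * energyDensity A v (y, s) := by
      rw [← integral_const_mul]
      refine setIntegral_mono (hρc.mul ((hsl hfl s).pow 2)).integrableOn_unitCell
        (continuous_const.mul (hρc.mul (hsl hEc s))).integrableOn_unitCell fun y => ?_
      have h4 := (Finset.single_le_sum (f := fun i => flux A i v (y, s) ^ 2)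
        (fun i _ => sq_nonneg _) (Finset.mem_univ i)).trans (hA.sum_sq_flux_le (v := v) (y, s))
      calc _ ≤ ρ y * (Λ / m * energyDensity A v (y, s)) :=
            mul_le_mul_of_nonneg_left h4 (hρ.nonneg y)
        _ = _ := by ring
    have h5 := hA.energy_le hv hρ s
    have h6 : ∫ y in unitCell d, ρ y * energyDensity A v (y, 0)
        ≤ (∫ y in unitCell d, ρ y) * D ^ 2 := by
      rw [← integral_mul_const]
      exact setIntegral_mono (hρc.mul (hsl hEc 0)).integrableOn_unitCell
        (hρc.mul continuous_const).integrableOn_unitCell fun y =>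
          mul_le_mul_of_nonneg_left (hE y) (hρ.nonneg y)
    have h7 : Real.exp ((d + Λ / m) * (Real.pi / N) * |s|)
        ≤ Real.exp ((d + Λ / m) * Real.pi) := by
      rw [mul_assoc]
      refine Real.exp_le_exp.2 (mul_le_mul_of_nonneg_left ?_ (by positivity))
      rw [div_mul_eq_mul_div, div_le_iff₀ hN]
      gcongr
    have h8 : (∫ y in unitCell d, ρ y * |flux A i v (y, s)|) ^ 2
        ≤ (c * D * ∫ y in unitCell d, ρ y) ^ 2 := by
      calc _ ≤ _ := h2
        _ ≤ (∫ y in unitCell d, ρ y) * (Λ / m * (Real.exp ((d + Λ / m) * Real.pi)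
            * ((∫ y in unitCell d, ρ y) * D ^ 2))) := by
            refine mul_le_mul_of_nonneg_left (h3.trans ?_) hρ0
            refine mul_le_mul_of_nonneg_left (h5.trans ?_) (by positivity)
            exact (mul_le_mul_of_nonneg_left h6 (Real.exp_pos _).le).trans
              (mul_le_mul_of_nonneg_right h7 (by positivity))
        _ = _ := by
            rw [mul_pow, mul_pow, Real.sq_sqrt (by positivity)]
            ring
    have h9 := le_of_sq_le_sq h8 (by positivity)
    calc _ ≤ _ := h1
      _ ≤ r₀⁻¹ * (2 * (1 : ℕ) * M / N) ^ d * (c * D * (Real.pi / 2 * N) ^ d) := by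
          gcongr
          exact h9.trans (by gcongr)
      _ = r₀⁻¹ * c * D * ((2 * (1 : ℕ) * M / N) * (Real.pi / 2 * N)) ^ d := by
          rw [mul_pow _ (Real.pi / 2 * N)]
          ring
      _ = _ := by
          have : (2 * (1 : ℕ) * M / N) * (Real.pi / 2 * N) = M * Real.pi := by
            push_cast
            field_simp
          rw [this]
          ring
  have hpt : ∀ s, ‖κ s * ∫ y : Fin d → ℝ, (∏ j, κ (y j)) * flux A i v (y, s)‖
      ≤ |κ s| * (r₀⁻¹ * (M * Real.pi) ^ d * c * D) := by
    intro s
    rw [Real.norm_eq_abs, abs_mul]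
    rcases le_or_gt |s| N with h | h
    · exact mul_le_mul_of_nonneg_left (hslice s h) (abs_nonneg _)
    · rw [show κ s = 0 from scaledKernel_eq_zero hK hN h]
      simp
  have hκi : Integrable κ := hκc.integrable_of_hasCompactSupport hs
  refine (norm_integral_le_of_norm_le (hκi.abs.mul_const _)
    (Filter.Eventually.of_forall hpt)).trans_eq ?_
  rw [integral_mul_const, integral_abs_scaledKernel hN]
  ring

/-- Averaged flux of a wave at arbitrary kernel width. -/
lemma IsEllipticCoeff.exists_flux_bound (hA : IsEllipticCoeff A m Λ)
    (hKs : ContDiff ℝ q K) (hK : Function.support K ⊆ Set.Icc (-1 : ℝ) 1) :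
    ∃ C, 0 ≤ C ∧ ∀ N, 0 < N → ∀ v, IsPeriodicWave A v → ∀ D, 0 ≤ D →
      (∀ y, energyDensity A v (y, 0) ≤ D ^ 2) → ∀ i,
      |∫ s, scaledKernel K N s * ∫ y : Fin d → ℝ, (∏ j, scaledKernel K N (y j)) * flux A i v (y, s)|
        ≤ C * D * N⁻¹ ^ q := by
  obtain ⟨C₁, hC₁, h₁⟩ := hA.exists_flux_bound_of_one_le hKs hK
  obtain ⟨C₂, hC₂, h₂⟩ := hA.exists_flux_bound_of_le_one hKs.continuous hK
  refine ⟨C₁ + C₂, by positivity, fun N hN v hv D hD hE i => ?_⟩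
  have hN' : 0 < N⁻¹ ^ q := by positivity
  rcases le_total 1 N with h | h
  · refine (h₁ N h v hv D hD hE i).trans ?_
    gcongr
    linarith
  · refine (h₂ N hN h v hv D hD hE i).trans ?_
    have h1 : 1 ≤ N⁻¹ ^ q := one_le_pow₀ ((one_le_inv₀ hN).2 h)
    calc C₂ * D ≤ C₂ * D * N⁻¹ ^ q := le_mul_of_one_le_right (by positivity) h1
      _ ≤ _ := by
        gcongr
        linarith

end WavePart

section Correctors

variable {d : ℕ}

/-- The `i`-th component of the cell flux `A(∇χʲ + eⱼ)`. -/
noncomputable def cellFlux (A : (Fin d → ℝ) → Matrix (Fin d) (Fin d) ℝ)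
    (χ : (Fin d → ℝ) → Fin d → ℝ) (j i : Fin d) (y : Fin d → ℝ) : ℝ :=
  ((A y).mulVec fun i' =>
    fderiv ℝ (fun w => χ w j) y (Pi.single i' 1) + if i' = j then (1 : ℝ) else 0) i

/-- The corrected linear profile `p · (y + χ(y))`. -/
noncomputable def correctedProfile (χ : (Fin d → ℝ) → Fin d → ℝ) (p y : Fin d → ℝ) : ℝ :=
  ∑ l, p l * (y l + χ y l)

variable {A : (Fin d → ℝ) → Matrix (Fin d) (Fin d) ℝ} {m Λ : ℝ} {χ : (Fin d → ℝ) → Fin d → ℝ}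

lemma cellFlux_eq_sum (j i : Fin d) (y : Fin d → ℝ) : cellFlux A χ j i y
    = ∑ i', A y i i' * (partialDeriv i' (fun w => χ w j) y + if i' = j then (1 : ℝ) else 0) :=
  rfl

lemma contDiff_cellFlux (hA : ∀ i j, ContDiff ℝ 1 fun y => A y i j)
    (hχ : ∀ j, ContDiff ℝ 2 fun y => χ y j) (j i : Fin d) : ContDiff ℝ 1 (cellFlux A χ j i) := by
  have h : cellFlux A χ j i = fun y => ∑ i', A y i i' *
      (fderiv ℝ (fun w => χ w j) y (Pi.single i' 1) + if i' = j then (1 : ℝ) else 0) := rfl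
  rw [h]
  refine ContDiff.sum fun i' _ => (hA i i').mul (ContDiff.add ?_ contDiff_const)
  exact ((hχ j).fderiv_right (m := 1) (by norm_num)).clm_apply contDiff_const

lemma latticePeriodic_cellFlux (hA : LatticePeriodic A)
    (hχ : ∀ j, LatticePeriodic fun y => χ y j) (j i : Fin d) :
    LatticePeriodic (cellFlux A χ j i) := by
  intro y k
  simp only [cellFlux_eq_sum, hA y k, fun i' => (hχ j).partialDeriv i' y k]

lemma contDiff_correctedProfile (hχ : ∀ j, ContDiff ℝ 2 fun y => χ y j) (p : Fin d → ℝ) :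
    ContDiff ℝ 2 (correctedProfile χ p) :=
  ContDiff.sum fun l _ => contDiff_const.mul ((contDiff_apply ℝ ℝ l).add (hχ l))

lemma partialDeriv_correctedProfile (hχ : ∀ j, ContDiff ℝ 2 fun y => χ y j) (p : Fin d → ℝ)
    (i : Fin d) (y : Fin d → ℝ) : partialDeriv i (correctedProfile χ p) y
      = ∑ l, p l * (partialDeriv i (fun w => χ w l) y + if i = l then (1 : ℝ) else 0) := by
  have h1 : ∀ l : Fin d, DifferentiableAt ℝ (fun y : Fin d → ℝ => y l) y := fun l => by fun_prop
  have h2 : ∀ l : Fin d, DifferentiableAt ℝ (fun y => χ y l) y := fun l =>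
    (hχ l).differentiable two_ne_zero y
  have h3 : ∀ l : Fin d, fderiv ℝ (fun y : Fin d → ℝ => y l) y (Pi.single i 1)
      = if i = l then (1 : ℝ) else 0 := by
    intro l
    rw [(hasFDerivAt_apply l y).fderiv]
    simp [Pi.single_apply, eq_comm]
  unfold correctedProfile partialDeriv
  rw [fderiv_fun_sum (A := fun l y => p l * (y l + χ y l))
    fun l _ => ((h1 l).add (h2 l)).const_mul (p l), _root_.sum_apply]
  refine Finset.sum_congr rfl fun l _ => ?_
  rw [fderiv_const_mul (a := fun y => y l + χ y l) ((h1 l).add (h2 l)), fderiv_fun_add (h1 l) (h2 l)]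
  simp only [_root_.smul_apply, _root_.add_apply, h3, smul_eq_mul]
  ring

lemma sum_mul_partialDeriv_correctedProfile (hχ : ∀ j, ContDiff ℝ 2 fun y => χ y j)
    (p : Fin d → ℝ) (i : Fin d) (y : Fin d → ℝ) :
    ∑ j, A y i j * partialDeriv j (correctedProfile χ p) y = ∑ l, p l * cellFlux A χ l i y := by
  simp_rw [partialDeriv_correctedProfile hχ, cellFlux_eq_sum, Finset.mul_sum]
  rw [Finset.sum_comm]
  refine Finset.sum_congr rfl fun l _ => Finset.sum_congr rfl fun j _ => by ring

lemma exists_isEllipticCoeff (hA : ∀ i j, ContDiff ℝ 1 fun y => A y i j) (hp : LatticePeriodic A)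
    (hsymm : ∀ y, (A y).IsSymm) (hm : 0 < m)
    (hpos : ∀ y ξ : Fin d → ℝ, m * ∑ i, ξ i ^ 2 ≤ ξ ⬝ᵥ (A y).mulVec ξ) :
    ∃ Λ, IsEllipticCoeff A m Λ := by
  have hper : ∀ i j, LatticePeriodic fun y => A y i j := fun i j y k => by simp only [hp y k]
  choose B hB0 hB using fun i j => (hper i j).exists_abs_le (hA i j).continuous
  refine ⟨∑ i, ∑ j, B i j ^ 2, hA, hp, fun y i j => (hsymm y).apply j i, hm, hpos,
    by positivity, fun y ξ => ?_⟩
  rw [Finset.sum_mul]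
  refine Finset.sum_le_sum fun i _ => (Finset.sum_mul_sq_le_sq_mul_sq _ _ _).trans ?_
  refine mul_le_mul_of_nonneg_right (Finset.sum_le_sum fun j _ => ?_) (by positivity)
  exact sq_le_sq' (abs_le.1 (hB i j y)).1 (abs_le.1 (hB i j y)).2

lemma spaceDeriv_static {g : (Fin d → ℝ) → ℝ} (hg : ContDiff ℝ 1 g) (i : Fin d)
    (z : (Fin d → ℝ) × ℝ) : spaceDeriv i (fun z => g z.1) z = partialDeriv i g z.1 := by
  have h : ContDiff ℝ 1 fun z : (Fin d → ℝ) × ℝ => g z.1 := hg.comp contDiff_fst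
  exact (partialDeriv_slice h i z.1 z.2).symm

lemma timeDeriv_static {g : (Fin d → ℝ) → ℝ} (hg : ContDiff ℝ 1 g)
    (z : (Fin d → ℝ) × ℝ) : timeDeriv (fun z => g z.1) z = 0 := by
  have h : ContDiff ℝ 1 fun z : (Fin d → ℝ) × ℝ => g z.1 := hg.comp contDiff_fst
  exact (hasDerivAt_slice h z.1 z.2).unique (hasDerivAt_const z.2 (g z.1))

lemma spaceDeriv_comp_smul (c : ℝ) (f : (Fin d → ℝ) × ℝ → ℝ) (i : Fin d) (z : (Fin d → ℝ) × ℝ) :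
    spaceDeriv i (fun z => f (c • z)) z = c * spaceDeriv i f (c • z) := by
  simp [spaceDeriv, fderiv_comp_smul]

lemma timeDeriv_comp_smul (c : ℝ) (f : (Fin d → ℝ) × ℝ → ℝ) (z : (Fin d → ℝ) × ℝ) :
    timeDeriv (fun z => f (c • z)) z = c * timeDeriv f (c • z) := by
  simp [timeDeriv, fderiv_comp_smul]

lemma spaceDeriv_sub {f g : (Fin d → ℝ) × ℝ → ℝ} (hf : ContDiff ℝ 1 f) (hg : ContDiff ℝ 1 g)
    (i : Fin d) (z : (Fin d → ℝ) × ℝ) :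
    spaceDeriv i (fun z => f z - g z) z = spaceDeriv i f z - spaceDeriv i g z := by
  unfold spaceDeriv
  rw [fderiv_fun_sub (hf.differentiable one_ne_zero z) (hg.differentiable one_ne_zero z)]
  rfl

lemma timeDeriv_sub {f g : (Fin d → ℝ) × ℝ → ℝ} (hf : ContDiff ℝ 1 f) (hg : ContDiff ℝ 1 g)
    (z : (Fin d → ℝ) × ℝ) :
    timeDeriv (fun z => f z - g z) z = timeDeriv f z - timeDeriv g z := by
  unfold timeDeriv
  rw [fderiv_fun_sub (hf.differentiable one_ne_zero z) (hg.differentiable one_ne_zero z)]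
  rfl

lemma spaceDeriv_const_mul {f : (Fin d → ℝ) × ℝ → ℝ} (hf : ContDiff ℝ 1 f) (c : ℝ)
    (i : Fin d) (z : (Fin d → ℝ) × ℝ) :
    spaceDeriv i (fun z => c * f z) z = c * spaceDeriv i f z := by
  unfold spaceDeriv
  rw [fderiv_const_mul (hf.differentiable one_ne_zero z)]
  rfl

lemma timeDeriv_const_mul {f : (Fin d → ℝ) × ℝ → ℝ} (hf : ContDiff ℝ 1 f) (c : ℝ)
    (z : (Fin d → ℝ) × ℝ) :
    timeDeriv (fun z => c * f z) z = c * timeDeriv f z := by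
  unfold timeDeriv
  rw [fderiv_const_mul (hf.differentiable one_ne_zero z)]
  rfl

end Correctors

section Rescaling

variable {d : ℕ}

/-- Solutions of the micro problem `∂ₜ²u = ∇·(A(x/ε)∇u)` with initial data `p · x` and zero
initial velocity that are `ε`-periodic perturbations of the linear data. -/
structure IsMicroSolution (A : (Fin d → ℝ) → Matrix (Fin d) (Fin d) ℝ) (ε : ℝ) (p : Fin d → ℝ)
    (u : (Fin d → ℝ) → ℝ → ℝ) : Prop where
  contDiff : ContDiff ℝ 2 fun z : (Fin d → ℝ) × ℝ => u z.1 z.2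
  wave : ∀ (x : Fin d → ℝ) (t : ℝ), deriv (deriv (u x)) t =
    ∑ i : Fin d, fderiv ℝ (fun z =>
      ((A (ε⁻¹ • z)).mulVec fun j =>
        fderiv ℝ (fun w => u w t) z (Pi.single j 1)) i) x (Pi.single i 1)
  initial : ∀ x : Fin d → ℝ, u x 0 = ∑ i : Fin d, p i * x i
  velocity : ∀ x : Fin d → ℝ, deriv (u x) 0 = 0
  periodic : ∀ (x : Fin d → ℝ) (t : ℝ) (k : Fin d → ℤ),
    u (x + fun i => ε * (k i : ℝ)) t = u x t + ∑ i : Fin d, p i * (ε * (k i : ℝ))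

/-- The deviation of the micro solution from the corrected profile, in microscopic variables. -/
noncomputable def rescaledDeviation (ε : ℝ) (u : (Fin d → ℝ) → ℝ → ℝ)
    (χ : (Fin d → ℝ) → Fin d → ℝ) (p : Fin d → ℝ) (z : (Fin d → ℝ) × ℝ) : ℝ :=
  ε⁻¹ * u (ε • z).1 (ε • z).2 - correctedProfile χ p z.1

variable {A : (Fin d → ℝ) → Matrix (Fin d) (Fin d) ℝ} {m Λ ε : ℝ} {χ : (Fin d → ℝ) → Fin d → ℝ}
  {p : Fin d → ℝ} {u : (Fin d → ℝ) → ℝ → ℝ}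

lemma contDiff_rescaled (hu : ContDiff ℝ 2 fun z : (Fin d → ℝ) × ℝ => u z.1 z.2) :
    ContDiff ℝ 2 fun z : (Fin d → ℝ) × ℝ => u (ε • z).1 (ε • z).2 :=
  hu.comp (g := fun z : (Fin d → ℝ) × ℝ => u z.1 z.2) (contDiff_const_smul ε)

lemma contDiff_rescaledDeviation (hu : ContDiff ℝ 2 fun z : (Fin d → ℝ) × ℝ => u z.1 z.2)
    (hχ : ∀ j, ContDiff ℝ 2 fun y => χ y j) : ContDiff ℝ 2 (rescaledDeviation ε u χ p) :=
  (contDiff_const.mul (contDiff_rescaled hu)).sub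
    ((contDiff_correctedProfile hχ p).comp contDiff_fst)

lemma spaceDeriv_rescaledDeviation (hε : 0 < ε)
    (hu : ContDiff ℝ 2 fun z : (Fin d → ℝ) × ℝ => u z.1 z.2)
    (hχ : ∀ j, ContDiff ℝ 2 fun y => χ y j) (i : Fin d) (z : (Fin d → ℝ) × ℝ) :
    spaceDeriv i (rescaledDeviation ε u χ p) z
      = spaceDeriv i (fun z => u z.1 z.2) (ε • z)
        - partialDeriv i (correctedProfile χ p) z.1 := by
  have h1 : ContDiff ℝ 1 fun z : (Fin d → ℝ) × ℝ => u (ε • z).1 (ε • z).2 :=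
    (contDiff_rescaled hu).of_le (by norm_num)
  have h2 : ContDiff ℝ 1 (correctedProfile χ p) :=
    (contDiff_correctedProfile hχ p).of_le (by norm_num)
  unfold rescaledDeviation
  rw [spaceDeriv_sub (f := fun z => ε⁻¹ * u (ε • z).1 (ε • z).2)
    (g := fun z => correctedProfile χ p z.1) (contDiff_const.mul h1) (h2.comp contDiff_fst),
    spaceDeriv_static h2, spaceDeriv_const_mul h1,
    spaceDeriv_comp_smul ε (fun z => u z.1 z.2), inv_mul_cancel_left₀ hε.ne']

lemma timeDeriv_rescaledDeviation (hε : 0 < ε)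
    (hu : ContDiff ℝ 2 fun z : (Fin d → ℝ) × ℝ => u z.1 z.2)
    (hχ : ∀ j, ContDiff ℝ 2 fun y => χ y j) (z : (Fin d → ℝ) × ℝ) :
    timeDeriv (rescaledDeviation ε u χ p) z = timeDeriv (fun z => u z.1 z.2) (ε • z) := by
  have h1 : ContDiff ℝ 1 fun z : (Fin d → ℝ) × ℝ => u (ε • z).1 (ε • z).2 :=
    (contDiff_rescaled hu).of_le (by norm_num)
  have h2 : ContDiff ℝ 1 (correctedProfile χ p) :=
    (contDiff_correctedProfile hχ p).of_le (by norm_num)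
  unfold rescaledDeviation
  rw [timeDeriv_sub (f := fun z => ε⁻¹ * u (ε • z).1 (ε • z).2)
    (g := fun z => correctedProfile χ p z.1) (contDiff_const.mul h1) (h2.comp contDiff_fst),
    timeDeriv_static h2, timeDeriv_const_mul h1,
    timeDeriv_comp_smul ε (fun z => u z.1 z.2), inv_mul_cancel_left₀ hε.ne', sub_zero]

lemma flux_rescaledDeviation (hε : 0 < ε)
    (hu : ContDiff ℝ 2 fun z : (Fin d → ℝ) × ℝ => u z.1 z.2)
    (hχ : ∀ j, ContDiff ℝ 2 fun y => χ y j) (i : Fin d) (z : (Fin d → ℝ) × ℝ) :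
    flux A i (rescaledDeviation ε u χ p) z
      = flux (fun x => A (ε⁻¹ • x)) i (fun z => u z.1 z.2) (ε • z)
        - ∑ l, p l * cellFlux A χ l i z.1 := by
  rw [← sum_mul_partialDeriv_correctedProfile hχ]
  simp only [flux, spaceDeriv_rescaledDeviation hε hu hχ, mul_sub, Finset.sum_sub_distrib,
    Prod.smul_fst, inv_smul_smul₀ hε.ne']

lemma mulVec_fderiv_eq_flux (hu : ContDiff ℝ 2 fun z : (Fin d → ℝ) × ℝ => u z.1 z.2) (i : Fin d)
    (x : Fin d → ℝ) (t : ℝ) :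
    ((A (ε⁻¹ • x)).mulVec fun j => fderiv ℝ (fun w => u w t) x (Pi.single j 1)) i
      = flux (fun x => A (ε⁻¹ • x)) i (fun z => u z.1 z.2) (x, t) := by
  have h : ∀ j, fderiv ℝ (fun w => u w t) x (Pi.single j 1)
      = spaceDeriv j (fun z : (Fin d → ℝ) × ℝ => u z.1 z.2) (x, t) := fun j =>
    partialDeriv_slice (hu.of_le (by norm_num)) j x t
  simp only [h]
  rfl

lemma IsMicroSolution.isPeriodicWave (hε : 0 < ε) (hu : IsMicroSolution A ε p u)
    (hA : ∀ i j, ContDiff ℝ 1 fun y => A y i j)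
    (hχ : ∀ j, ContDiff ℝ 2 fun y => χ y j) (hχp : ∀ j, LatticePeriodic fun y => χ y j)
    (hcell : ∀ j y, ∑ i, partialDeriv i (cellFlux A χ j i) y = 0) :
    IsPeriodicWave A (rescaledDeviation ε u χ p) := by
  have hU := hu.contDiff
  have hU1 : ContDiff ℝ 1 fun z : (Fin d → ℝ) × ℝ => u z.1 z.2 := hU.of_le (by norm_num)
  have hderiv : ∀ x t, deriv (u x) t = timeDeriv (fun z => u z.1 z.2) (x, t) := fun x t =>
    (hasDerivAt_slice hU1 x t).deriv
  have hAε : ∀ i j, ContDiff ℝ 1 fun x => A (ε⁻¹ • x) i j := fun i j =>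
    (hA i j).comp (contDiff_const_smul ε⁻¹)
  have hflux : ∀ i, ContDiff ℝ 1
      (flux (fun x => A (ε⁻¹ • x)) i (fun z : (Fin d → ℝ) × ℝ => u z.1 z.2)) := fun i =>
    ContDiff.sum fun j _ => ((hAε i j).comp contDiff_fst).mul (contDiff_spaceDeriv hU j)
  have hc : ∀ l i, ContDiff ℝ 1 (cellFlux A χ l i) := contDiff_cellFlux hA hχ
  refine ⟨contDiff_rescaledDeviation hU hχ, fun s y k => ?_, fun z => ?_, fun y => ?_⟩
  · have h := hu.periodic (ε • y) (ε * s) k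
    have h1 : ε • (y + fun i => (k i : ℝ)) = ε • y + fun i => ε * (k i : ℝ) := by
      ext i; simp [mul_add]
    simp only [rescaledDeviation, correctedProfile, Prod.smul_fst, Prod.smul_snd, smul_eq_mul, h1,
      h, fun l => hχp l y k, Pi.add_apply]
    have h2 : ∑ i, p i * (ε * (k i : ℝ)) = ε * ∑ i, p i * (k i : ℝ) := by
      rw [Finset.mul_sum]; exact Finset.sum_congr rfl fun i _ => by ring
    have h3 : ∑ l, p l * (y l + (k l : ℝ) + χ y l)
        = ∑ l, p l * (y l + χ y l) + ∑ i, p i * (k i : ℝ) := by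
      rw [← Finset.sum_add_distrib]; exact Finset.sum_congr rfl fun i _ => by ring
    rw [h2, h3, mul_add, inv_mul_cancel_left₀ hε.ne']
    ring
  · have h1 : timeDeriv (rescaledDeviation ε u χ p)
        = fun z => timeDeriv (fun z => u z.1 z.2) (ε • z) :=
      funext (timeDeriv_rescaledDeviation hε hU hχ)
    have h2 : ∀ i, flux A i (rescaledDeviation ε u χ p) = _ := fun i =>
      funext (flux_rescaledDeviation (A := A) hε hU hχ i)
    have h3 : timeDeriv (timeDeriv fun z => u z.1 z.2) (ε • z)
        = ∑ i, spaceDeriv i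
          (flux (fun x => A (ε⁻¹ • x)) i (fun z : (Fin d → ℝ) × ℝ => u z.1 z.2)) (ε • z) := by
      have h := hu.wave (ε • z).1 (ε • z).2
      rw [show deriv (u (ε • z).1) = fun t => timeDeriv (fun z => u z.1 z.2) ((ε • z).1, t) from
        funext fun t => hderiv _ t, (hasDerivAt_slice (contDiff_timeDeriv hU) _ _).deriv] at h
      refine h.trans (Finset.sum_congr rfl fun i _ => ?_)
      simp only [mulVec_fderiv_eq_flux hU]
      exact partialDeriv_slice (hflux i) i _ _
    have h4 : ∀ i, ContDiff ℝ 1 fun y => ∑ l, p l * cellFlux A χ l i y := fun i =>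
      ContDiff.sum fun l _ => contDiff_const.mul (hc l i)
    have h5 : ∀ i, partialDeriv i (fun y => ∑ l, p l * cellFlux A χ l i y) z.1
        = ∑ l, p l * partialDeriv i (cellFlux A χ l i) z.1 := by
      intro i
      have hd : ∀ l, DifferentiableAt ℝ (cellFlux A χ l i) z.1 := fun l =>
        (hc l i).differentiable one_ne_zero _
      unfold partialDeriv
      rw [fderiv_fun_sum (A := fun l y => p l * cellFlux A χ l i y)
        fun l _ => (hd l).const_mul (p l), _root_.sum_apply]
      refine Finset.sum_congr rfl fun l _ => ?_
      rw [fderiv_const_mul (hd l)]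
      rfl
    have h6 : ∑ i, ∑ l, p l * partialDeriv i (cellFlux A χ l i) z.1 = 0 := by
      rw [Finset.sum_comm]
      simp_rw [← Finset.mul_sum, hcell, mul_zero]
      simp
    rw [h1, timeDeriv_comp_smul, h3, Finset.mul_sum]
    simp_rw [h2]
    rw [← sub_zero (∑ i, ε * _), ← h6, ← Finset.sum_sub_distrib]
    refine Finset.sum_congr rfl fun i _ => ?_
    rw [spaceDeriv_sub (f := fun z => flux (fun x => A (ε⁻¹ • x)) i (fun z => u z.1 z.2) (ε • z))
      (g := fun z => ∑ l, p l * cellFlux A χ l i z.1) ((hflux i).comp (contDiff_const_smul ε))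
      ((h4 i).comp contDiff_fst), spaceDeriv_comp_smul, spaceDeriv_static (h4 i), h5]
  · rw [timeDeriv_rescaledDeviation hε hU hχ]
    have := hu.velocity (ε • y)
    rw [hderiv] at this
    simpa using this

lemma IsMicroSolution.spaceDeriv_rescaledDeviation_zero (hε : 0 < ε)
    (hu : IsMicroSolution A ε p u) (hχ : ∀ j, ContDiff ℝ 2 fun y => χ y j) (i : Fin d)
    (y : Fin d → ℝ) : spaceDeriv i (rescaledDeviation ε u χ p) (y, 0)
      = -∑ l, p l * partialDeriv i (fun w => χ w l) y := by
  have hv : ContDiff ℝ 1 (rescaledDeviation ε u χ p) :=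
    (contDiff_rescaledDeviation hu.contDiff hχ).of_le (by norm_num)
  have h : (fun x => rescaledDeviation ε u χ p (x, 0)) = fun x => -∑ l, p l * χ x l := by
    ext x
    simp only [rescaledDeviation, correctedProfile, Prod.smul_fst, Prod.smul_snd, mul_zero,
      hu.initial, Pi.smul_apply, smul_eq_mul, mul_add, Finset.sum_add_distrib]
    have : ∑ i, p i * (ε * x i) = ε * ∑ i, p i * x i := by
      rw [Finset.mul_sum]; exact Finset.sum_congr rfl fun i _ => by ring
    rw [this, inv_mul_cancel_left₀ hε.ne']
    ring
  have hd : ∀ l, DifferentiableAt ℝ (fun w => χ w l) y := fun l =>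
    (hχ l).differentiable two_ne_zero _
  rw [← partialDeriv_slice hv, h]
  unfold partialDeriv
  rw [fderiv_fun_neg, fderiv_fun_sum (A := fun l y => p l * χ y l)
    fun l _ => (hd l).const_mul (p l), _root_.neg_apply, _root_.sum_apply]
  congr 1
  refine Finset.sum_congr rfl fun l _ => ?_
  rw [fderiv_const_mul (hd l)]
  rfl

lemma exists_initial_energy_bound (hA : IsEllipticCoeff A m Λ)
    (hχ : ∀ j, ContDiff ℝ 2 fun y => χ y j) (hχp : ∀ j, LatticePeriodic fun y => χ y j) :
    ∃ C, 0 ≤ C ∧ ∀ ε, 0 < ε → ∀ p u, IsMicroSolution A ε p u →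
      IsPeriodicWave A (rescaledDeviation ε u χ p) →
      ∀ y, energyDensity A (rescaledDeviation ε u χ p) (y, 0)
        ≤ (C * √(∑ i, p i ^ 2)) ^ 2 := by
  choose B hB0 hB using fun i l => ((hχp l).partialDeriv i).exists_abs_le
    (continuous_partialDeriv ((hχ l).of_le (by norm_num)) i)
  have hΛ := hA.bound_nonneg
  refine ⟨√((1 + Λ) * ∑ i, ∑ l, B i l ^ 2), by positivity, fun ε hε p u hu hv y => ?_⟩
  rw [mul_pow, Real.sq_sqrt (by positivity), Real.sq_sqrt (by positivity)]
  set ξ : Fin d → ℝ := fun i => spaceDeriv i (rescaledDeviation ε u χ p) (y, 0)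
  have h1 : ∑ i, ξ i ^ 2 ≤ (∑ i, ∑ l, B i l ^ 2) * ∑ i, p i ^ 2 := by
    rw [Finset.sum_mul]
    refine Finset.sum_le_sum fun i _ => ?_
    simp only [ξ, hu.spaceDeriv_rescaledDeviation_zero hε hχ, neg_sq]
    refine (Finset.sum_mul_sq_le_sq_mul_sq _ _ _).trans ?_
    rw [mul_comm]
    refine mul_le_mul_of_nonneg_right (Finset.sum_le_sum fun l _ => ?_) (by positivity)
    exact sq_le_sq' (abs_le.1 (hB i l y)).1 (abs_le.1 (hB i l y)).2
  have h2 : ∑ i, ξ i * ∑ j, A y i j * ξ j ≤ (1 + Λ) * ∑ i, ξ i ^ 2 := by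
    have h3 : ∀ i, ξ i * ∑ j, A y i j * ξ j ≤ ξ i ^ 2 + (∑ j, A y i j * ξ j) ^ 2 := fun i => by
      nlinarith [sq_nonneg (ξ i - ∑ j, A y i j * ξ j), sq_nonneg (ξ i + ∑ j, A y i j * ξ j)]
    refine (Finset.sum_le_sum fun i _ => h3 i).trans ?_
    rw [Finset.sum_add_distrib]
    linarith [hA.bound y ξ]
  have h3 : energyDensity A (rescaledDeviation ε u χ p) (y, 0)
      = ∑ i, ξ i * ∑ j, A y i j * ξ j := by
    simp only [energyDensity, hv.velocity, flux, ξ]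
    ring
  rw [h3, mul_assoc]
  exact h2.trans (mul_le_mul_of_nonneg_left h1 (by positivity))

end Rescaling

section Averaging

variable {d : ℕ} {A : (Fin d → ℝ) → Matrix (Fin d) (Fin d) ℝ} {m Λ : ℝ}
  {χ : (Fin d → ℝ) → Fin d → ℝ} {K : ℝ → ℝ}

lemma scaledKernel_div (ε η s : ℝ) :
    scaledKernel K (η / ε) s = ε * scaledKernel K η (ε * s) := by
  unfold scaledKernel
  rw [inv_div, div_div_eq_mul_div, mul_comm s ε]
  ring

/-- Kernel averages at width `η` become averages at width `η / ε` in microscopic variables. -/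
lemma integral_kernel_rescale {ε η : ℝ} (hε : 0 < ε) (F : (Fin d → ℝ) × ℝ → ℝ) :
    ∫ t, ∫ x : Fin d → ℝ, scaledKernel K η t * (∏ j, scaledKernel K η (x j)) * F (x, t)
      = ∫ s, scaledKernel K (η / ε) s
          * ∫ y : Fin d → ℝ, (∏ j, scaledKernel K (η / ε) (y j)) * F (ε • (y, s)) := by
  have hinner : ∀ s, ∫ y : Fin d → ℝ, (∏ j, scaledKernel K (η / ε) (y j)) * F (ε • (y, s))
      = ∫ x : Fin d → ℝ, (∏ j, scaledKernel K η (x j)) * F (x, ε * s) := by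
    intro s
    have h := Measure.integral_comp_smul volume
      (fun x : Fin d → ℝ => (∏ j, scaledKernel K η (x j)) * F (x, ε * s)) ε
    have h1 : ∀ y : Fin d → ℝ, (∏ j, scaledKernel K (η / ε) (y j)) * F (ε • (y, s))
        = ε ^ d * ((∏ j, scaledKernel K η ((ε • y) j)) * F (ε • y, ε * s)) := by
      intro y
      simp only [scaledKernel_div ε η, Finset.prod_mul_distrib, Finset.prod_const,
        Finset.card_univ, Fintype.card_fin, Pi.smul_apply, smul_eq_mul, Prod.smul_mk, mul_assoc]
    simp_rw [h1]
    rw [integral_const_mul, h, Module.finrank_fin_fun, abs_of_pos (by positivity), smul_eq_mul,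
      mul_inv_cancel_left₀ (by positivity)]
  simp_rw [hinner, scaledKernel_div ε η, mul_assoc, integral_const_mul]
  rw [Measure.integral_comp_mul_left (fun t => scaledKernel K η t
      * ∫ x : Fin d → ℝ, (∏ j, scaledKernel K η (x j)) * F (x, t)) ε,
    abs_of_pos (by positivity), smul_eq_mul, mul_inv_cancel_left₀ hε.ne']

lemma integral_kernel_add_static {κ : ℝ → ℝ} (hκ : Continuous κ) (hs : HasCompactSupport κ)
    (hmass : ∫ t, κ t = 1) {f : (Fin d → ℝ) × ℝ → ℝ} (hf : Continuous f)
    {g : (Fin d → ℝ) → ℝ} (hg : Continuous g) :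
    ∫ s, κ s * ∫ y : Fin d → ℝ, (∏ j, κ (y j)) * (f (y, s) + g y)
      = (∫ s, κ s * ∫ y : Fin d → ℝ, (∏ j, κ (y j)) * f (y, s))
        + ∫ y : Fin d → ℝ, (∏ j, κ (y j)) * g y := by
  have hg' : Continuous fun z : (Fin d → ℝ) × ℝ => g z.1 := hg.comp continuous_fst
  have h1 := integral_kernel_swap hκ hs (f := fun z => f z + g z.1) (hf.add hg')
  have h2 : ∀ y, timeAvg κ (fun z => f z + g z.1) y = timeAvg κ f y + g y := by
    intro y
    unfold timeAvg
    simp_rw [mul_add]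
    rw [integral_add (f := fun s => κ s * f (y, s)) (g := fun s => κ s * g y)
      (timeAvg_integrable hκ hs hf y) (timeAvg_integrable hκ hs hg' y), integral_mul_const,
      hmass, one_mul]
  rw [h1, integral_kernel_swap hκ hs hf]
  simp_rw [h2, mul_add]
  exact integral_add (f := fun y => (∏ j, κ (y j)) * timeAvg κ f y)
    (integrable_prod_mul hκ hs (continuous_timeAvg hκ hs hf)) (integrable_prod_mul hκ hs hg)

lemma abs_sum_mul_le_sqrt (p b : Fin d → ℝ) {B : Fin d → ℝ} (hb : ∀ l, |b l| ≤ B l) :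
    |∑ l, p l * b l| ≤ (∑ l, B l) * √(∑ i, p i ^ 2) := by
  rw [Finset.sum_mul]
  refine (Finset.abs_sum_le_sum_abs _ _).trans (Finset.sum_le_sum fun l _ => ?_)
  have h : |p l| ≤ √(∑ i, p i ^ 2) := Real.abs_le_sqrt
    (Finset.single_le_sum (f := fun i => p i ^ 2) (fun i _ => sq_nonneg _) (Finset.mem_univ l))
  rw [abs_mul, mul_comm]
  exact mul_le_mul (hb l) h (abs_nonneg _) ((abs_nonneg _).trans (hb l))

/-- Kernel averages of the homogenized part of the flux. -/
lemma exists_cellFlux_average_bound {q : ℕ} (hA : IsEllipticCoeff A m Λ)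
    (hχ : ∀ j, ContDiff ℝ 2 fun y => χ y j) (hχp : ∀ j, LatticePeriodic fun y => χ y j)
    (hKs : ContDiff ℝ q K) (hK : Function.support K ⊆ Set.Icc (-1 : ℝ) 1)
    (hmass : ∫ t, K t = 1) (i : Fin d) :
    ∃ C, 0 ≤ C ∧ ∀ N, 0 < N → ∀ p : Fin d → ℝ,
      |(∫ y : Fin d → ℝ, (∏ j, scaledKernel K N (y j)) * ∑ l, p l * cellFlux A χ l i y)
          - ∑ l, p l * ∫ y in unitCell d, cellFlux A χ l i y|
        ≤ C * √(∑ i, p i ^ 2) * N⁻¹ ^ q := by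
  have hc : ∀ l, Continuous (cellFlux A χ l i) := fun l =>
    (contDiff_cellFlux hA.contDiff hχ l i).continuous
  have hper : ∀ l, LatticePeriodic (cellFlux A χ l i) := fun l =>
    latticePeriodic_cellFlux hA.periodic hχp l i
  choose B hB0 hB using fun l => (hper l).exists_abs_le (hc l)
  have hJ : 0 ≤ ∫ t, |iteratedDeriv q K t| := integral_nonneg fun _ => abs_nonneg _
  have hI : 0 ≤ ∫ t, |K t| := integral_nonneg fun _ => abs_nonneg _
  have hBs : 0 ≤ ∑ l, B l := Finset.sum_nonneg fun l _ => hB0 l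
  refine ⟨(∑ j ∈ Finset.range d, (∫ t, |K t|) ^ j)
    * (2 ^ (q + 1) * (∫ t, |iteratedDeriv q K t|) * ∑ l, B l), by positivity,
    fun N hN p => ?_⟩
  have h := abs_integral_prod_mul_sub_le (contDiff_scaledKernel (N := N) hKs)
    (hasCompactSupport_scaledKernel hK hN) ((integral_scaledKernel hN).trans hmass) d
    (g := fun y => ∑ l, p l * cellFlux A χ l i y)
    (continuous_finsetSum _ fun l _ => continuous_const.mul (hc l))
    (fun y k => Finset.sum_congr rfl fun l _ => congrArg (p l * ·) (hper l y k))
    fun y => abs_sum_mul_le_sqrt p _ fun l => hB l y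
  rw [integral_abs_iteratedDeriv_scaledKernel hKs hN, integral_abs_scaledKernel hN,
    integral_finsetSum (f := fun l y => p l * cellFlux A χ l i y) _
      fun l _ => (continuous_const.mul (hc l)).integrableOn_unitCell] at h
  simp_rw [integral_const_mul] at h
  exact h.trans_eq (by ring)

/-- The averaged flux of micro solutions is close to the homogenized flux, componentwise. -/
lemma exists_microFlux_bound {q : ℕ} (hA : IsEllipticCoeff A m Λ)
    (hχ : ∀ j, ContDiff ℝ 2 fun y => χ y j) (hχp : ∀ j, LatticePeriodic fun y => χ y j)
    (hcell : ∀ j y, ∑ i, partialDeriv i (cellFlux A χ j i) y = 0)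
    (hKs : ContDiff ℝ q K) (hK : Function.support K ⊆ Set.Icc (-1 : ℝ) 1)
    (hmass : ∫ t, K t = 1) (i : Fin d) :
    ∃ C, 0 ≤ C ∧ ∀ ε η, 0 < ε → 0 < η → ∀ p u, IsMicroSolution A ε p u →
      |(∫ t, ∫ x : Fin d → ℝ, scaledKernel K η t * (∏ j, scaledKernel K η (x j))
            * flux (fun x => A (ε⁻¹ • x)) i (fun z => u z.1 z.2) (x, t))
          - ∑ l, p l * ∫ y in unitCell d, cellFlux A χ l i y|
        ≤ C * √(∑ i, p i ^ 2) * (ε / η) ^ q := by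
  obtain ⟨C₁, hC₁, h₁⟩ := hA.exists_flux_bound hKs hK
  obtain ⟨C₂, hC₂, h₂⟩ := exists_initial_energy_bound hA hχ hχp
  obtain ⟨C₃, hC₃, h₃⟩ := exists_cellFlux_average_bound hA hχ hχp hKs hK hmass i
  refine ⟨C₁ * C₂ + C₃, by positivity, fun ε η hε hη p u hu => ?_⟩
  have hN : 0 < η / ε := by positivity
  have hv := hu.isPeriodicWave hε hA.contDiff hχ hχp hcell
  have hsplit : ∀ (y : Fin d → ℝ) (s : ℝ),
      flux (fun x => A (ε⁻¹ • x)) i (fun z => u z.1 z.2) (ε • (y, s))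
        = flux A i (rescaledDeviation ε u χ p) (y, s) + ∑ l, p l * cellFlux A χ l i y := by
    intro y s
    rw [flux_rescaledDeviation hε hu.contDiff hχ]
    ring
  rw [integral_kernel_rescale hε]
  simp_rw [hsplit]
  rw [integral_kernel_add_static (contDiff_scaledKernel hKs).continuous
    (hasCompactSupport_scaledKernel hK hN) ((integral_scaledKernel hN).trans hmass)
    (hA.contDiff_flux hv.contDiff i).continuous
    (g := fun y => ∑ l, p l * cellFlux A χ l i y)
    (continuous_finsetSum _ fun l _ => continuous_const.mul
      (contDiff_cellFlux hA.contDiff hχ l i).continuous), add_sub_assoc, ← inv_div η ε]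
  refine (abs_add_le _ _).trans ((add_le_add (h₁ _ hN _ hv _ (by positivity)
    (h₂ ε hε p u hu hv) i) (h₃ _ hN p)).trans_eq ?_)
  ring

end Averaging

/-- HMM flux approximation (Theorem 1, first part): for a smooth, `ℤ^d`-periodic,
symmetric, uniformly positive definite coefficient `A`, cell-problem correctors
`χ`, homogenized matrix `Ā = ∫ A(I + ∇χ)`, and a kernel `K ∈ 𝕂^{p',q}` with
`q ≥ 1`, there is `C` independent of `ε`, `η` and `p` such that for every micro
solution `u^ε` of the wave equation with linear initial data `p·x` and zero
initial velocity (and `u^ε − p·x` being `εℤ^d`-periodic), the kernel-averaged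
flux `F̃ = ∫∫ K_τ(t)K_η(x₁)⋯K_η(x_d) A(x/ε)∇u^ε dx dt` (with `τ = η`) satisfies
`|F̃ − Āp| ≤ C |p| (ε/η)^q`. -/
theorem hmm_flux_approximation
    (d : ℕ) (hd : 1 ≤ d)
    (A : (Fin d → ℝ) → Matrix (Fin d) (Fin d) ℝ)
    (hA_smooth : ∀ i j : Fin d, ContDiff ℝ (⊤ : ℕ∞) fun y => A y i j)
    (hA_per : ∀ (y : Fin d → ℝ) (k : Fin d → ℤ), A (y + fun i => (k i : ℝ)) = A y)
    (hA_symm : ∀ y : Fin d → ℝ, (A y).IsSymm)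
    (hA_pos : ∃ mlb : ℝ, 0 < mlb ∧ ∀ (y ξ : Fin d → ℝ),
      mlb * ∑ i : Fin d, ξ i ^ 2 ≤ ξ ⬝ᵥ (A y).mulVec ξ)
    -- cell-problem correctors χ = (χ¹,…,χ^d): ∇·(A(y)(∇χ^j + e_j)) = 0
    (χ : (Fin d → ℝ) → Fin d → ℝ)
    (hχ_smooth : ∀ j : Fin d, ContDiff ℝ (⊤ : ℕ∞) fun y => χ y j)
    (hχ_per : ∀ (y : Fin d → ℝ) (k : Fin d → ℤ) (j : Fin d),
      χ (y + fun i => (k i : ℝ)) j = χ y j)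
    (hχ_cell : ∀ (j : Fin d) (y : Fin d → ℝ),
      ∑ i : Fin d, fderiv ℝ (fun z =>
        ((A z).mulVec fun i' =>
          fderiv ℝ (fun w => χ w j) z (Pi.single i' 1)
            + if i' = j then (1 : ℝ) else 0) i) y (Pi.single i 1) = 0)
    -- the homogenized matrix Ā = ∫_{[0,1]^d} A(y)(I + ∇χ(y)) dy
    (Abar : Matrix (Fin d) (Fin d) ℝ)
    (hAbar : ∀ i j : Fin d, Abar i j =
      ∫ y in Set.univ.pi fun _ : Fin d => Set.Icc (0:ℝ) 1,
        ((A y).mulVec fun i' =>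
          fderiv ℝ (fun w => χ w j) y (Pi.single i' 1)
            + if i' = j then (1 : ℝ) else 0) i)
    -- the averaging kernel K ∈ 𝕂^{p',q}, q ≥ 1
    (p' q : ℕ) (hq : 1 ≤ q)
    (K : ℝ → ℝ)
    (hK_smooth : ContDiff ℝ q K)
    (hK_supp : Function.support K ⊆ Set.Icc (-1 : ℝ) 1)
    (hK_mass : (∫ t : ℝ, K t) = 1)
    (hK_mom : ∀ r : ℕ, 1 ≤ r → r ≤ p' → (∫ t : ℝ, K t * t ^ r) = 0) :
    ∃ C : ℝ, ∀ ε η : ℝ, 0 < ε → 0 < η →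
      ∀ p : Fin d → ℝ, p ≠ 0 →
      ∀ u : (Fin d → ℝ) → ℝ → ℝ,
        -- u^ε is C²
        ContDiff ℝ 2 (fun z : (Fin d → ℝ) × ℝ => u z.1 z.2) →
        -- the wave equation ∂²_t u^ε = ∇·(A(x/ε)∇u^ε)
        (∀ (x : Fin d → ℝ) (t : ℝ), deriv (deriv (u x)) t =
          ∑ i : Fin d, fderiv ℝ (fun z =>
            ((A (ε⁻¹ • z)).mulVec fun j =>
              fderiv ℝ (fun w => u w t) z (Pi.single j 1)) i) x (Pi.single i 1)) →
        -- initial data u^ε(x,0) = p·x, ∂_t u^ε(x,0) = 0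
        (∀ x : Fin d → ℝ, u x 0 = ∑ i : Fin d, p i * x i) →
        (∀ x : Fin d → ℝ, deriv (u x) 0 = 0) →
        -- x ↦ u^ε(x,t) − p·x is (εℤ^d)-periodic
        (∀ (x : Fin d → ℝ) (t : ℝ) (k : Fin d → ℤ),
          u (x + fun i => ε * (k i : ℝ)) t = u x t + ∑ i : Fin d, p i * (ε * (k i : ℝ))) →
        -- the averaged flux F̃ (with τ = η)
        ∀ Ftil : Fin d → ℝ,
          (∀ i : Fin d, Ftil i =
            ∫ t : ℝ, ∫ x : Fin d → ℝ,
              (η⁻¹ * K (t / η)) * (∏ j : Fin d, η⁻¹ * K (x j / η)) *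
                ((A (ε⁻¹ • x)).mulVec fun j =>
                  fderiv ℝ (fun w => u w t) x (Pi.single j 1)) i) →
          Real.sqrt (∑ i : Fin d, (Ftil i - Abar.mulVec p i) ^ 2)
            ≤ C * Real.sqrt (∑ i : Fin d, p i ^ 2) * (ε / η) ^ q := by
  obtain ⟨m, hm, hpos⟩ := hA_pos
  have hA1 : ∀ i j, ContDiff ℝ 1 fun y => A y i j := fun i j =>
    (hA_smooth i j).of_le (by exact_mod_cast le_top)
  have hχ2 : ∀ j, ContDiff ℝ 2 fun y => χ y j := fun j =>
    contDiff_infty.1 (hχ_smooth j) 2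
  obtain ⟨Λ, hA⟩ := exists_isEllipticCoeff hA1 hA_per hA_symm hm hpos
  have hχp : ∀ j, LatticePeriodic fun y => χ y j := fun j y k => hχ_per y k j
  choose C hC0 hC using exists_microFlux_bound hA hχ2 hχp hχ_cell hK_smooth hK_supp hK_mass
  refine ⟨∑ i, C i, fun ε η hε hη p _ u hu hwave hinit hvel hper Ftil hF => ?_⟩
  have hmicro : IsMicroSolution A ε p u := ⟨hu, hwave, hinit, hvel, hper⟩
  have hcomp : ∀ i, |Ftil i - Abar.mulVec p i| ≤ C i * (√(∑ i, p i ^ 2) * (ε / η) ^ q) := by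
    intro i
    have h := hC i ε η hε hη p u hmicro
    have hbar : Abar.mulVec p i = ∑ l, p l * ∫ y in unitCell d, cellFlux A χ l i y :=
      (Finset.sum_congr rfl fun l _ => by rw [hAbar, mul_comm]; rfl :
        ∑ l, Abar i l * p l = _)
    rw [hF, hbar, ← mul_assoc]
    simp_rw [mulVec_fderiv_eq_flux hu]
    exact h
  set R := √(∑ i, p i ^ 2) * (ε / η) ^ q
  have hR : 0 ≤ R := by positivity
  have hCs : 0 ≤ ∑ i, C i := Finset.sum_nonneg fun i _ => hC0 i
  rw [mul_assoc]
  refine Real.sqrt_le_iff.2 ⟨by positivity, ?_⟩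
  calc ∑ i, (Ftil i - Abar.mulVec p i) ^ 2 ≤ ∑ i, (C i * R) ^ 2 :=
        Finset.sum_le_sum fun i _ => sq_le_sq' (abs_le.1 (hcomp i)).1 (abs_le.1 (hcomp i)).2
    _ ≤ (∑ i, C i * R) ^ 2 :=
        Finset.sum_sq_le_sq_sum_of_nonneg fun i _ => mul_nonneg (hC0 i) hR
    _ = ((∑ i, C i) * R) ^ 2 := by rw [Finset.sum_mul]
end

section
/- Let p, q ≥ 1 be integers, K ∈ 𝕂^{p,q}, d ≥ 1, and let F : ℝ^d → ℝ be smooth and ℤ^d-periodic. Define the tensor kernel K_η(x) = K_η(x₁)K_η(x₂)⋯K_η(x_d). Then there exists a constant C, independent of ε and η, such that for all ε, η > 0, |∫_{ℝ^d} K_η(x) F(x/ε) dx − ∫_{[0,1]^d} F(y) dy| ≤ C (ε/η)^q. -/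
open MeasureTheory

/-- A continuous `1`-periodic function with zero mean has a `1`-periodic antiderivative with zero
mean, and the antiderivative satisfies every uniform bound of the function. -/
theorem exists_periodic_antideriv_of_integral_eq_zero {f : ℝ → ℝ} (hf : Continuous f)
    (hper : Function.Periodic f 1) (hmean : ∫ t in (0 : ℝ)..1, f t = 0) {M : ℝ}
    (hM : ∀ x, |f x| ≤ M) :
    ∃ g : ℝ → ℝ, (∀ x, HasDerivAt g (f x) x) ∧ Function.Periodic g 1 ∧
      ∫ t in (0 : ℝ)..1, g t = 0 ∧ ∀ x, |g x| ≤ M := by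
  have hint (a b : ℝ) : IntervalIntegrable f volume a b := hf.intervalIntegrable a b
  let G : ℝ → ℝ := fun x => ∫ t in (0 : ℝ)..x, f t
  have hG (x : ℝ) : HasDerivAt G (f x) x :=
    intervalIntegral.integral_hasDerivAt_right (hint _ _)
      hf.aestronglyMeasurable.stronglyMeasurableAtFilter hf.continuousAt
  have hGc : Continuous G := continuous_iff_continuousAt.2 fun x => (hG x).continuousAt
  have hGper : Function.Periodic G 1 := fun x => by
    have h := intervalIntegral.integral_add_adjacent_intervals (hint 0 x) (hint x (x + 1))
    have h' := hper.intervalIntegral_add_eq x 0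
    rw [zero_add] at h'
    rw [h', hmean, add_zero] at h
    exact h.symm
  let c : ℝ := ∫ t in (0 : ℝ)..1, G t
  refine ⟨fun x => G x - c, fun x => (hG x).sub_const c, fun x => by simp only [hGper x], ?_,
    fun x => ?_⟩
  · rw [intervalIntegral.integral_sub (hGc.intervalIntegrable _ _) (by simp)]
    simp [c]
  · have hc : c = ∫ t in x..x + 1, G t := by
      rw [hGper.intervalIntegral_add_eq x 0, zero_add]
    have hdiff : G x - c = ∫ t in x..x + 1, (G x - G t) := by
      rw [intervalIntegral.integral_sub (by simp) (hGc.intervalIntegrable _ _), hc]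
      simp
    have hbound : ∀ t ∈ Set.uIoc x (x + 1), ‖G x - G t‖ ≤ M := fun t ht => by
      rw [Set.uIoc_of_le (by linarith)] at ht
      have h1 : G x - G t = ∫ s in t..x, f s :=
        intervalIntegral.integral_interval_sub_left (hint 0 x) (hint 0 t)
      have h2 := intervalIntegral.norm_integral_le_of_norm_le_const (a := t) (b := x) (f := f)
        (C := M) fun s _ => hM s
      rw [h1]
      refine h2.trans (mul_le_of_le_one_right ((abs_nonneg _).trans (hM 0)) ?_)
      rw [abs_le]
      constructor <;> linarith [ht.1, ht.2]
    have h := intervalIntegral.norm_integral_le_of_norm_le_const hbound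
    rw [← hdiff, Real.norm_eq_abs] at h
    simpa using h

/-- Repeated integration by parts: a `C^q` compactly supported kernel integrates a zero-mean
periodic function of frequency `l` to `O(l⁻¹ ^ q)`. -/
theorem exists_abs_integral_mul_periodic_le (q : ℕ) (K : ℝ → ℝ) (hK : ContDiff ℝ q K)
    (hKs : HasCompactSupport K) :
    ∃ C : ℝ, 0 ≤ C ∧ ∀ (f : ℝ → ℝ) (M : ℝ), Continuous f → Function.Periodic f 1 →
      ∫ t in (0 : ℝ)..1, f t = 0 → (∀ x, |f x| ≤ M) → ∀ l : ℝ, 0 < l →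
      |∫ x, K x * f (l * x)| ≤ C * M * l⁻¹ ^ q := by
  induction q generalizing K with
  | zero =>
    refine ⟨∫ x, |K x|, integral_nonneg fun x => abs_nonneg _,
      fun f M hf hper hmean hM l hl => ?_⟩
    have hKi : Integrable K := hK.continuous.integrable_of_hasCompactSupport hKs
    rw [pow_zero, mul_one, ← integral_mul_const, ← Real.norm_eq_abs]
    refine norm_integral_le_of_norm_le (hKi.abs.mul_const M)
      (Filter.Eventually.of_forall fun x => ?_)
    rw [Real.norm_eq_abs, abs_mul]
    exact mul_le_mul_of_nonneg_left (hM _) (abs_nonneg _)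
  | succ q ih =>
    have hK' : ContDiff ℝ (q + 1) K := by exact_mod_cast hK
    obtain ⟨hKd, -, hKd'⟩ := contDiff_succ_iff_deriv.1 hK'
    obtain ⟨C, hC, h⟩ := ih (deriv K) hKd' hKs.deriv
    refine ⟨C, hC, fun f M hf hper hmean hM l hl => ?_⟩
    obtain ⟨g, hg, hgper, hgmean, hgM⟩ :=
      exists_periodic_antideriv_of_integral_eq_zero hf hper hmean hM
    have hgc : Continuous g := continuous_iff_continuousAt.2 fun x => (hg x).continuousAt
    have hparts : ∫ x, K x * (f (l * x) * l) = -∫ x, deriv K x * g (l * x) := by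
      refine integral_mul_deriv_eq_deriv_mul_of_integrable
        (u := K) (v := fun x => g (l * x)) (fun x _ => (hKd x).hasDerivAt)
        (fun x _ => ?_) ?_ ?_ ?_
      · have := (hg (l * x)).comp x ((hasDerivAt_id x).const_mul l)
        simpa [Function.comp_def] using this
      · exact (hK.continuous.mul (by fun_prop)).integrable_of_hasCompactSupport hKs.mul_right
      · exact (hKd'.continuous.mul (by fun_prop)).integrable_of_hasCompactSupport
          hKs.deriv.mul_right
      · exact (hK.continuous.mul (by fun_prop)).integrable_of_hasCompactSupport hKs.mul_right
    have heq : ∫ x, K x * f (l * x) = -(l⁻¹ * ∫ x, deriv K x * g (l * x)) := by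
      rw [← mul_neg, ← hparts, ← integral_const_mul]
      congr with x
      field_simp
    rw [heq, abs_neg, abs_mul, abs_of_pos (inv_pos.2 hl), pow_succ]
    calc l⁻¹ * |∫ x, deriv K x * g (l * x)| ≤ l⁻¹ * (C * M * l⁻¹ ^ q) :=
          mul_le_mul_of_nonneg_left (h g M hgc hgper hgmean hgM l hl) (inv_pos.2 hl).le
      _ = C * M * (l⁻¹ ^ q * l⁻¹) := by ring

/-- One-dimensional kernel averaging, with a constant uniform over periodic functions of given
sup norm. -/
theorem exists_abs_integral_kernel_mul_sub_mean_le {q : ℕ} {K : ℝ → ℝ} (hK : ContDiff ℝ q K)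
    (hKs : HasCompactSupport K) (hK_mass : ∫ t, K t = 1) :
    ∃ C : ℝ, 0 ≤ C ∧ ∀ (f : ℝ → ℝ) (M : ℝ), Continuous f → Function.Periodic f 1 →
      (∀ x, |f x| ≤ M) → ∀ l : ℝ, 0 < l →
      |(∫ x, K x * f (l * x)) - ∫ t in (0 : ℝ)..1, f t| ≤ C * M * l⁻¹ ^ q := by
  obtain ⟨C, hC, h⟩ := exists_abs_integral_mul_periodic_le q K hK hKs
  refine ⟨C * 2, by positivity, fun f M hf hper hM l hl => ?_⟩
  set m : ℝ := ∫ t in (0 : ℝ)..1, f t with hm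
  have hmM : |m| ≤ M := by
    simpa using intervalIntegral.norm_integral_le_of_norm_le_const (a := (0 : ℝ)) (b := 1)
      (f := f) (C := M) fun s _ => hM s
  have key := h (fun x => f x - m) (2 * M) (by fun_prop) (fun x => by simp only [hper x])
    (by rw [intervalIntegral.integral_sub (hf.intervalIntegrable _ _) (by simp), ← hm]; simp)
    (fun x => (abs_sub _ _).trans (by linarith [hM x])) l hl
  have hsplit : ∫ x, K x * (f (l * x) - m) = (∫ x, K x * f (l * x)) - m := by
    simp_rw [mul_sub]
    rw [integral_sub, integral_mul_const, hK_mass, one_mul]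
    · exact (hK.continuous.mul (by fun_prop)).integrable_of_hasCompactSupport hKs.mul_right
    · exact (hK.continuous.integrable_of_hasCompactSupport hKs).mul_const m
  rw [hsplit] at key
  linarith

/-- Fubini for a power of a measure, integrating the first coordinate first. -/
theorem integral_pi_succ_eq_integral_cons (μ : Measure ℝ) [SigmaFinite μ] {d : ℕ}
    {f : (Fin (d + 1) → ℝ) → ℝ} (hf : Integrable f (Measure.pi fun _ => μ)) :
    Integrable (fun y : Fin d → ℝ => ∫ t, f (Fin.cons t y) ∂μ) (Measure.pi fun _ => μ) ∧
      ∫ x, f x ∂(Measure.pi fun _ => μ) =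
        ∫ y : Fin d → ℝ, ∫ t, f (Fin.cons t y) ∂μ ∂(Measure.pi fun _ => μ) := by
  have hmp := (measurePreserving_piFinSuccAbove (fun _ : Fin (d + 1) => μ) 0).symm
  have hcons (z : ℝ × (Fin d → ℝ)) :
      (MeasurableEquiv.piFinSuccAbove (fun _ : Fin (d + 1) => ℝ) 0).symm z =
        Fin.cons z.1 z.2 := by
    simp [MeasurableEquiv.piFinSuccAbove_symm_apply, Fin.insertNthEquiv]
  have hint : Integrable (fun z : ℝ × (Fin d → ℝ) => f (Fin.cons z.1 z.2))
      (μ.prod (Measure.pi fun _ => μ)) := by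
    have := (hmp.integrable_comp_emb (MeasurableEquiv.measurableEmbedding _)).2 hf
    simpa only [Function.comp_def, hcons] using this
  refine ⟨hint.integral_prod_right, ?_⟩
  rw [← integral_prod_symm _ hint, ← hmp.integral_comp']
  simp only [hcons]

/-- A continuous `ℤ^d`-periodic function is bounded. -/
theorem exists_abs_le_of_continuous_of_periodic {d : ℕ} {F : (Fin d → ℝ) → ℝ}
    (hF : Continuous F)
    (hper : ∀ (y : Fin d → ℝ) (k : Fin d → ℤ), F (y + fun i => (k i : ℝ)) = F y) :
    ∃ M : ℝ, ∀ y, |F y| ≤ M := by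
  obtain ⟨M, hM⟩ := (isCompact_univ_pi fun _ : Fin d =>
    isCompact_Icc (a := (0 : ℝ)) (b := 1)).exists_bound_of_continuousOn hF.continuousOn
  refine ⟨M, fun y => ?_⟩
  have hfract : F (fun i => Int.fract (y i)) = F y := by
    rw [← hper (fun i => Int.fract (y i)) fun i => ⌊y i⌋]
    congr with i
    exact Int.fract_add_floor (y i)
  rw [← hfract]
  exact hM _ fun i _ => ⟨Int.fract_nonneg _, (Int.fract_lt_one _).le⟩

/-- Kernel averaging with a tensor kernel at unit scale, with a constant uniform over periodic
functions of given sup norm. -/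
theorem exists_abs_integral_tensor_kernel_mul_sub_mean_le {q : ℕ} {K : ℝ → ℝ}
    (hK : ContDiff ℝ q K) (hKs : HasCompactSupport K) (hK_mass : ∫ t, K t = 1) (d : ℕ) :
    ∃ C : ℝ, 0 ≤ C ∧ ∀ (F : (Fin d → ℝ) → ℝ) (M : ℝ), Continuous F →
      (∀ (y : Fin d → ℝ) (k : Fin d → ℤ), F (y + fun i => (k i : ℝ)) = F y) →
      (∀ y, |F y| ≤ M) → ∀ l : ℝ, 0 < l →
      |(∫ x : Fin d → ℝ, (∏ i, K (x i)) * F (l • x))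
        - ∫ y in Set.univ.pi fun _ : Fin d => Set.Icc (0 : ℝ) 1, F y| ≤ C * M * l⁻¹ ^ q := by
  have hKi : Integrable K := hK.continuous.integrable_of_hasCompactSupport hKs
  have hKprod (n : ℕ) : Integrable fun x : Fin n → ℝ => ∏ i, K (x i) :=
    Integrable.fintype_prod fun _ => hKi
  obtain ⟨C₁, hC₁, h₁⟩ := exists_abs_integral_kernel_mul_sub_mean_le hK hKs hK_mass
  induction d with
  | zero =>
    refine ⟨0, le_rfl, fun F M hF hper hM l hl => ?_⟩
    have hFl (x : Fin 0 → ℝ) : F (l • x) = F x := congrArg F (Subsingleton.elim _ _)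
    have hset : (Set.univ.pi fun _ : Fin 0 => Set.Icc (0 : ℝ) 1) = Set.univ :=
      Set.eq_univ_of_forall fun x i => i.elim0
    simp only [hFl, hset, Finset.univ_eq_empty, Finset.prod_empty, one_mul, Measure.restrict_univ,
      sub_self, abs_zero, zero_mul, le_refl]
  | succ d ih =>
    obtain ⟨C, hC, h⟩ := ih
    set A : ℝ := ∫ y : Fin d → ℝ, |∏ i, K (y i)| with hA
    have hA0 : 0 ≤ A := integral_nonneg fun y => abs_nonneg _
    refine ⟨A * C₁ + C, by positivity, fun F M hF hper hM l hl => ?_⟩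
    have hcons : Continuous fun z : ℝ × (Fin d → ℝ) =>
        (Fin.cons z.1 z.2 : Fin (d + 1) → ℝ) := by fun_prop
    let G : (Fin d → ℝ) → ℝ := fun y => ∫ t in (0 : ℝ)..1, F (Fin.cons t y)
    have hGc : Continuous G :=
      intervalIntegral.continuous_parametric_intervalIntegral_of_continuous'
        (f := fun y t => F (Fin.cons t y)) (hF.comp (hcons.comp continuous_swap)) 0 1
    have hGper (y : Fin d → ℝ) (k : Fin d → ℤ) : G (y + fun i => (k i : ℝ)) = G y := by
      refine intervalIntegral.integral_congr fun t _ => ?_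
      have hk := hper (Fin.cons t y) (Fin.cons 0 k)
      rw [← hk]
      congr 1
      funext i
      refine Fin.cases ?_ (fun j => ?_) i <;> simp
    have hGM (y : Fin d → ℝ) : |G y| ≤ M := by
      simpa using intervalIntegral.norm_integral_le_of_norm_le_const (a := (0 : ℝ)) (b := 1)
        (f := fun t => F (Fin.cons t y)) (C := M) fun s _ => hM _
    have hmean : ∫ y in Set.univ.pi fun _ : Fin (d + 1) => Set.Icc (0 : ℝ) 1, F y =
        ∫ y in Set.univ.pi fun _ : Fin d => Set.Icc (0 : ℝ) 1, G y := by
      simp only [volume_pi, Measure.restrict_pi_pi]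
      rw [(integral_pi_succ_eq_integral_cons (volume.restrict (Set.Icc (0 : ℝ) 1)) _).2]
      · simp only [G, intervalIntegral.integral_of_le zero_le_one, integral_Icc_eq_integral_Ioc]
      · exact Integrable.of_bound hF.aestronglyMeasurable M (Filter.Eventually.of_forall hM)
    let I : (Fin d → ℝ) → ℝ := fun y => ∫ t, K t * F (Fin.cons (l * t) (l • y))
    have hI (y : Fin d → ℝ) : |I y - G (l • y)| ≤ C₁ * M * l⁻¹ ^ q := by
      refine h₁ (fun t => F (Fin.cons t (l • y))) M (by fun_prop) (fun t => ?_) (fun t => hM _) l hl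
      have hk := hper (Fin.cons t (l • y)) (Fin.cons 1 0)
      simp only
      rw [← hk]
      congr 1
      funext i
      refine Fin.cases ?_ (fun j => ?_) i <;> simp
    have hint : Integrable fun x : Fin (d + 1) → ℝ => (∏ i, K (x i)) * F (l • x) :=
      (hKprod _).mul_bdd (by fun_prop) (Filter.Eventually.of_forall fun x => hM _)
    have hinner (y : Fin d → ℝ) :
        ∫ t, (∏ i, K ((Fin.cons t y : Fin (d + 1) → ℝ) i)) *
          F (l • (Fin.cons t y : Fin (d + 1) → ℝ)) = (∏ i, K (y i)) * I y := by
      rw [← integral_const_mul]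
      congr with t
      have hs : l • (Fin.cons t y : Fin (d + 1) → ℝ) = Fin.cons (l * t) (l • y) := by
        funext i
        refine Fin.cases ?_ (fun j => ?_) i <;> simp
      rw [hs, Fin.prod_univ_succ]
      simp only [Fin.cons_zero, Fin.cons_succ]
      ring
    obtain ⟨hfub_int, hfub⟩ :
        Integrable (fun y : Fin d → ℝ => (∏ i, K (y i)) * I y) ∧
          ∫ x : Fin (d + 1) → ℝ, (∏ i, K (x i)) * F (l • x) =
            ∫ y : Fin d → ℝ, (∏ i, K (y i)) * I y := by
      simp only [← hinner]
      exact integral_pi_succ_eq_integral_cons volume hint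
    have hGint : Integrable fun y : Fin d → ℝ => (∏ i, K (y i)) * G (l • y) :=
      (hKprod _).mul_bdd (by fun_prop) (Filter.Eventually.of_forall fun x => hGM _)
    have herr : |(∫ y : Fin d → ℝ, (∏ i, K (y i)) * I y) -
        ∫ y : Fin d → ℝ, (∏ i, K (y i)) * G (l • y)| ≤ A * (C₁ * M * l⁻¹ ^ q) := by
      rw [← integral_sub hfub_int hGint, hA, ← integral_mul_const, ← Real.norm_eq_abs]
      refine norm_integral_le_of_norm_le ((hKprod d).abs.mul_const _)
        (Filter.Eventually.of_forall fun y => ?_)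
      rw [← mul_sub, Real.norm_eq_abs, abs_mul]
      exact mul_le_mul_of_nonneg_left (hI y) (abs_nonneg _)
    rw [hfub, hmean]
    calc _ ≤ A * (C₁ * M * l⁻¹ ^ q) + C * M * l⁻¹ ^ q :=
          (abs_sub_le _ _ _).trans (add_le_add herr (h G M hGc hGper hGM l hl))
      _ = (A * C₁ + C) * M * l⁻¹ ^ q := by ring


/-- Multidimensional kernel averaging: for `K ∈ 𝕂^{p,q}`, the tensor kernel
`K_η(x) = K_η(x₁)⋯K_η(x_d)`, and `F` smooth and `ℤ^d`-periodic,
`|∫ K_η(x) F(x/ε) dx − ∫_{[0,1]^d} F(y) dy| ≤ C (ε/η)^q` with `C` independent of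
`ε` and `η`. -/
theorem kernel_average_multidim
    (p q : ℕ) (hp : 1 ≤ p) (hq : 1 ≤ q)
    (K : ℝ → ℝ)
    (hK_smooth : ContDiff ℝ q K)
    (hK_supp : Function.support K ⊆ Set.Icc (-1 : ℝ) 1)
    (hK_mass : (∫ t : ℝ, K t) = 1)
    (hK_mom : ∀ r : ℕ, 1 ≤ r → r ≤ p → (∫ t : ℝ, K t * t ^ r) = 0)
    (d : ℕ) (hd : 1 ≤ d)
    (F : (Fin d → ℝ) → ℝ)
    (hF_smooth : ContDiff ℝ (⊤ : ℕ∞) F)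
    (hF_per : ∀ (y : Fin d → ℝ) (k : Fin d → ℤ), F (y + fun i => (k i : ℝ)) = F y) :
    ∃ C : ℝ, ∀ ε η : ℝ, 0 < ε → 0 < η →
      |(∫ x : Fin d → ℝ, (∏ i : Fin d, η⁻¹ * K (x i / η)) * F (ε⁻¹ • x))
        - ∫ y in Set.univ.pi fun _ : Fin d => Set.Icc (0:ℝ) 1, F y|
        ≤ C * (ε / η) ^ q := by
  have hKs : HasCompactSupport K :=
    HasCompactSupport.intro' isCompact_Icc isClosed_Icc fun x hx =>
      Function.notMem_support.1 fun hx' => hx (hK_supp hx')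
  obtain ⟨C, -, h⟩ := exists_abs_integral_tensor_kernel_mul_sub_mean_le hK_smooth hKs hK_mass d
  obtain ⟨M, hM⟩ := exists_abs_le_of_continuous_of_periodic hF_smooth.continuous hF_per
  refine ⟨C * M, fun ε η hε hη => ?_⟩
  have key := h F M hF_smooth.continuous hF_per hM (η / ε) (by positivity)
  have hscale : ∫ x : Fin d → ℝ, (∏ i : Fin d, η⁻¹ * K (x i / η)) * F (ε⁻¹ • x) =
      ∫ x : Fin d → ℝ, (∏ i, K (x i)) * F ((η / ε) • x) := by
    have hs := Measure.integral_comp_inv_smul_of_nonneg (volume : Measure (Fin d → ℝ))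
      (fun x => (∏ i, K (x i)) * F ((η / ε) • x)) hη.le
    have hη' : (η ^ d)⁻¹ * η ^ d = 1 := inv_mul_cancel₀ (by positivity)
    rw [Module.finrank_fin_fun, smul_eq_mul] at hs
    rw [← one_mul (∫ x : Fin d → ℝ, (∏ i, K (x i)) * F ((η / ε) • x)), ← hη', mul_assoc, ← hs,
      ← integral_const_mul]
    congr with x
    have hx : (η / ε) • η⁻¹ • x = ε⁻¹ • x := by
      rw [smul_smul]
      congr 1
      field_simp
    rw [hx, Finset.prod_mul_distrib, Finset.prod_const, Finset.card_univ, Fintype.card_fin,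
      inv_pow, mul_assoc]
    simp only [Pi.smul_apply, smul_eq_mul, div_eq_inv_mul]
  rw [hscale]
  rwa [inv_div] at key
end
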